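/- arXiv:1502.02590 — 8 statements merged into one kernel-verified Lean document; each statement's English description precedes it below -/
import Mathlib

section
/- Let f : ℝ^d → ℝ be a measurable classifier, bounded on the ball B = {x ∈ ℝ^d : ‖x‖₂ ≤ M}, and suppose f satisfies Assumption (A) with parameters τ > 0 and 0 < γ ≤ 1, i.e. for all x ∈ B, dist(x, {y : f(y) ≤ 0}) ≤ τ·max(0, f(x))^γ and dist(x, {y : f(y) ≥ 0}) ≤ τ·max(0, −f(x))^γ. Let μ = p₁ μ₁ + p₋₁ μ₋₁ be a probability measure supported on B, with class-conditional probability measures μ₁, μ₋₁ and weights p₁, p₋₁ ≥ 0, p₁ + p₋₁ = 1, and assume the integrals below exist. Then ρ_adv(f) ≤ 4^{1−γ} τ ( p₁ E_{μ₁}[f(x)] − p₋₁ E_{μ₋₁}[f(x)] + 2 ‖f‖_∞ R(f) )^γ. -/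
open MeasureTheory Metric

/-- The minimal norm of an adversarial perturbation flipping the sign of `f` at `x`:
`Δ_adv(x; f) = inf {‖r‖₂ : f(x)·f(x+r) ≤ 0}`. -/
noncomputable def deltaAdv {d : ℕ} (f : EuclideanSpace ℝ (Fin d) → ℝ)
    (x : EuclideanSpace ℝ (Fin d)) : ℝ :=
  sInf {t : ℝ | ∃ r : EuclideanSpace ℝ (Fin d), ‖r‖ = t ∧ f x * f (x + r) ≤ 0}

/-- The robustness at `x` is at most the distance to the set where `f x * f y ≤ 0`. If that set is
empty, both sides are zero by convention. -/
theorem deltaAdv_le_infDist {d : ℕ} {f : EuclideanSpace ℝ (Fin d) → ℝ}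
    {x : EuclideanSpace ℝ (Fin d)}
    {s : Set (EuclideanSpace ℝ (Fin d))} (hs : ∀ y, f x * f y ≤ 0 ↔ y ∈ s) :
    deltaAdv f x ≤ Metric.infDist x s := by
  rcases s.eq_empty_or_nonempty with rfl | hne
  · have : {t : ℝ | ∃ r : EuclideanSpace ℝ (Fin d), ‖r‖ = t ∧ f x * f (x + r) ≤ 0} = ∅ := by
      ext t
      simp [hs]
    simp [deltaAdv, this]
  · rw [Metric.le_infDist hne]
    intro y hy
    refine csInf_le ⟨0, ?_⟩ ⟨y - x, by rw [dist_comm, dist_eq_norm], by simpa using (hs y).2 hy⟩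
    rintro t ⟨r, rfl, -⟩
    exact norm_nonneg r

theorem deltaAdv_le_rpow {d : ℕ} {f : EuclideanSpace ℝ (Fin d) → ℝ} {x : EuclideanSpace ℝ (Fin d)}
    {τ γ : ℝ} (hτ : 0 ≤ τ)
    (hpos : Metric.infDist x {y | f y ≤ 0} ≤ τ * (max 0 (f x)) ^ γ)
    (hneg : Metric.infDist x {y | 0 ≤ f y} ≤ τ * (max 0 (-f x)) ^ γ) :
    deltaAdv f x ≤ τ * |f x| ^ γ := by
  rcases lt_trichotomy (f x) 0 with h | h | h
  · rw [abs_of_neg h]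
    rw [max_eq_right (by linarith)] at hneg
    exact (deltaAdv_le_infDist fun y =>
      ⟨fun hy => not_lt.1 fun hy' => hy.not_gt (mul_pos_of_neg_of_neg h hy'),
        mul_nonpos_of_nonpos_of_nonneg h.le⟩).trans hneg
  · have h0 : deltaAdv f x ≤ Metric.infDist x Set.univ :=
      deltaAdv_le_infDist fun y => by simp [h]
    rw [Metric.infDist_zero_of_mem (Set.mem_univ x)] at h0
    exact h0.trans (by positivity)
  · rw [abs_of_pos h]
    rw [max_eq_right h.le] at hpos
    exact (deltaAdv_le_infDist fun y =>
      ⟨fun hy => not_lt.1 fun hy' => hy.not_gt (mul_pos h hy'),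
        mul_nonpos_of_nonneg_of_nonpos h.le⟩).trans hpos

theorem integrable_abs_rpow {α : Type*} [MeasurableSpace α] {μ : Measure α} [IsFiniteMeasure μ]
    {f : α → ℝ} (hf : Integrable f μ) {γ : ℝ} (hγ0 : 0 ≤ γ) (hγ1 : γ ≤ 1) :
    Integrable (fun x => |f x| ^ γ) μ := by
  refine ((integrable_const (1 : ℝ)).add hf.abs).mono'
    (hf.abs.aemeasurable.pow_const γ).aestronglyMeasurable (Filter.Eventually.of_forall fun x => ?_)
  rw [Real.norm_of_nonneg (by positivity)]
  have hx := abs_nonneg (f x)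
  simp only [Pi.add_apply]
  rcases le_total |f x| 1 with h | h
  · linarith [Real.rpow_le_one hx h hγ0]
  · linarith [Real.rpow_le_self_of_one_le h hγ1]

theorem integral_abs_rpow_le {α : Type*} [MeasurableSpace α] {μ : Measure α}
    [IsProbabilityMeasure μ] {f : α → ℝ} (hf : Integrable f μ) {γ : ℝ} (hγ0 : 0 ≤ γ)
    (hγ1 : γ ≤ 1) : ∫ x, |f x| ^ γ ∂μ ≤ (∫ x, |f x| ∂μ) ^ γ :=
  (Real.concaveOn_rpow hγ0 hγ1).le_map_integral
    (Real.continuous_rpow_const hγ0).continuousOn isClosed_Ici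
    (Filter.Eventually.of_forall fun x => abs_nonneg (f x)) hf.abs
    (integrable_abs_rpow hf hγ0 hγ1)

theorem integral_abs_le_of_neg_le {α : Type*} [MeasurableSpace α] {μ : Measure α}
    [IsFiniteMeasure μ] {g : α → ℝ} (hg : Integrable g μ) {s : Set α} (hs : MeasurableSet s)
    (hgs : ∀ x ∉ s, 0 ≤ g x) {C : ℝ} (hC : ∀ᵐ x ∂μ, |g x| ≤ C) :
    ∫ x, |g x| ∂μ ≤ ∫ x, g x ∂μ + 2 * C * (μ s).toReal := by
  have hi : Integrable (s.indicator fun _ => 2 * C) μ := (integrable_const _).indicator hs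
  have h : ∫ x, |g x| ∂μ ≤ ∫ x, (g x + s.indicator (fun _ => 2 * C) x) ∂μ := by
    refine integral_mono_ae hg.abs (hg.add hi) ?_
    filter_upwards [hC] with x hx
    by_cases hxs : x ∈ s
    · simp only [Set.indicator_of_mem hxs]
      linarith [neg_abs_le (g x)]
    · simp [Set.indicator_of_notMem hxs, abs_of_nonneg (hgs x hxs)]
  rw [integral_add hg hi, integral_indicator_const _ hs, smul_eq_mul, mul_comm (μ.real s)] at h
  exact h

/-- **Lemma 1 (general upper bound on adversarial robustness).**
If a bounded measurable classifier `f` satisfies Assumption (A) with parameters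
`τ > 0`, `0 < γ ≤ 1` on the ball `B = {‖x‖ ≤ M}` supporting the data distribution
`μ = p₁ μ₁ + p₋₁ μ₋₁`, then
`ρ_adv(f) ≤ 4^(1-γ) τ (p₁ E_{μ₁}[f] − p₋₁ E_{μ₋₁}[f] + 2 ‖f‖_∞ R(f))^γ`. -/
theorem adv_robustness_general_upper_bound {d : ℕ} (M τ γ : ℝ) (hM : 0 < M)
    (hτ : 0 < τ) (hγ0 : 0 < γ) (hγ1 : γ ≤ 1)
    (f : EuclideanSpace ℝ (Fin d) → ℝ) (hf : Measurable f)
    (hbdd : ∃ C : ℝ, ∀ x ∈ Metric.closedBall (0 : EuclideanSpace ℝ (Fin d)) M, |f x| ≤ C)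
    (hA : ∀ x ∈ Metric.closedBall (0 : EuclideanSpace ℝ (Fin d)) M,
      Metric.infDist x {y | f y ≤ 0} ≤ τ * (max 0 (f x)) ^ γ ∧
      Metric.infDist x {y | 0 ≤ f y} ≤ τ * (max 0 (-f x)) ^ γ)
    (p1 pm1 : ℝ) (hp1 : 0 ≤ p1) (hpm1 : 0 ≤ pm1) (hsum : p1 + pm1 = 1)
    (μ1 μm1 : Measure (EuclideanSpace ℝ (Fin d)))
    [IsProbabilityMeasure μ1] [IsProbabilityMeasure μm1]
    (hs1 : μ1 (Metric.closedBall (0 : EuclideanSpace ℝ (Fin d)) M)ᶜ = 0)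
    (hsm1 : μm1 (Metric.closedBall (0 : EuclideanSpace ℝ (Fin d)) M)ᶜ = 0)
    (μ : Measure (EuclideanSpace ℝ (Fin d)))
    (hμ : μ = ENNReal.ofReal p1 • μ1 + ENNReal.ofReal pm1 • μm1)
    (hint1 : Integrable f μ1) (hintm1 : Integrable f μm1)
    (hintadv : Integrable (fun x => deltaAdv f x) μ) :
    ∫ x, deltaAdv f x ∂μ ≤
      (4 : ℝ) ^ (1 - γ) * τ *
        (p1 * ∫ x, f x ∂μ1 - pm1 * ∫ x, f x ∂μm1 +
          2 * sSup ((fun x => |f x|) '' Metric.closedBall (0 : EuclideanSpace ℝ (Fin d)) M) *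
            (p1 * (μ1 {x | f x < 0}).toReal + pm1 * (μm1 {x | 0 ≤ f x}).toReal)) ^ γ := by
  set B := Metric.closedBall (0 : EuclideanSpace ℝ (Fin d)) M
  set S := sSup ((fun x => |f x|) '' B)
  have hS : ∀ x ∈ B, |f x| ≤ S := fun x hx => by
    obtain ⟨C, hC⟩ := hbdd
    exact le_csSup ⟨C, by rintro _ ⟨y, hy, rfl⟩; exact hC y hy⟩ ⟨x, hx, rfl⟩
  have hB1 : ∀ᵐ x ∂μ1, x ∈ B := hs1
  have hBm1 : ∀ᵐ x ∂μm1, x ∈ B := hsm1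
  have hprob : IsProbabilityMeasure μ := ⟨by
    simp [hμ, ← ENNReal.ofReal_add hp1 hpm1, hsum]⟩
  have hB : ∀ᵐ x ∂μ, x ∈ B := by
    rw [hμ, ae_add_measure_iff]
    exact ⟨Measure.ae_smul_measure hB1 _, Measure.ae_smul_measure hBm1 _⟩
  have hi1 := hint1.smul_measure (c := ENNReal.ofReal p1) ENNReal.ofReal_ne_top
  have him1 := hintm1.smul_measure (c := ENNReal.ofReal pm1) ENNReal.ofReal_ne_top
  have hint : Integrable f μ := hμ ▸ hi1.add_measure him1
  have habs : ∫ x, |f x| ∂μ = p1 * ∫ x, |f x| ∂μ1 + pm1 * ∫ x, |f x| ∂μm1 := by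
    rw [hμ, integral_add_measure hi1.abs him1.abs, integral_smul_measure, integral_smul_measure,
      ENNReal.toReal_ofReal hp1, ENNReal.toReal_ofReal hpm1, smul_eq_mul, smul_eq_mul]
  have h1 : ∫ x, |f x| ∂μ1 ≤ ∫ x, f x ∂μ1 + 2 * S * (μ1 {x | f x < 0}).toReal :=
    integral_abs_le_of_neg_le hint1 (measurableSet_lt hf measurable_const)
      (fun x hx => not_lt.1 hx) (hB1.mono hS)
  have hm1 : ∫ x, |f x| ∂μm1 ≤ -∫ x, f x ∂μm1 + 2 * S * (μm1 {x | 0 ≤ f x}).toReal := by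
    have h := integral_abs_le_of_neg_le (C := S) hintm1.neg (measurableSet_le measurable_const hf)
      (fun x (hx : ¬ 0 ≤ f x) => neg_nonneg.2 (not_le.1 hx).le)
      (hBm1.mono fun x hx => by simpa using hS x hx)
    simpa [integral_neg] using h
  have hbound := add_le_add (mul_le_mul_of_nonneg_left h1 hp1) (mul_le_mul_of_nonneg_left hm1 hpm1)
  rw [← habs] at hbound
  have habs0 : 0 ≤ ∫ x, |f x| ∂μ := integral_nonneg fun x => abs_nonneg (f x)
  calc ∫ x, deltaAdv f x ∂μ
      ≤ ∫ x, τ * |f x| ^ γ ∂μ := by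
        refine integral_mono_ae hintadv ((integrable_abs_rpow hint hγ0.le hγ1).const_mul τ) ?_
        filter_upwards [hB] with x hx
        exact deltaAdv_le_rpow hτ.le (hA x hx).1 (hA x hx).2
    _ = τ * ∫ x, |f x| ^ γ ∂μ := integral_const_mul _ _
    _ ≤ τ * (∫ x, |f x| ∂μ) ^ γ := by
        gcongr
        exact integral_abs_rpow_le hint hγ0.le hγ1
    _ ≤ (4 : ℝ) ^ (1 - γ) * τ * (∫ x, |f x| ∂μ) ^ γ := by
        gcongr
        exact le_mul_of_one_le_left hτ.le
          (Real.one_le_rpow (by norm_num) (sub_nonneg.2 hγ1))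
    _ ≤ _ := by
        gcongr
        exact hbound.trans_eq (by ring)
end

section
/- Let f(x) = wᵀx + b be a linear classifier on ℝ^d with w ≠ 0 and |b| ≤ M ‖w‖₂. Let μ = p₁ μ₁ + p₋₁ μ₋₁ be a probability measure supported on the ball B = {x : ‖x‖₂ ≤ M}, with class-conditional probability measures μ₁, μ₋₁ and weights p₁, p₋₁ ≥ 0, p₁ + p₋₁ = 1, and assume the means E_{μ₁}[x], E_{μ₋₁}[x] exist. Then ρ_adv(f) ≤ ‖p₁ E_{μ₁}[x] − p₋₁ E_{μ₋₁}[x]‖₂ + M (|p₁ − p₋₁| + 4 R(f)). -/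
open MeasureTheory Metric
open scoped RealInnerProductSpace

/-- The distance from `x` to a sign change of an affine function is `|f x| / ‖w‖`. -/
theorem deltaAdv_affine {d : ℕ} {w : EuclideanSpace ℝ (Fin d)} (hw : w ≠ 0) (b : ℝ)
    (x : EuclideanSpace ℝ (Fin d)) :
    deltaAdv (fun y => ⟪w, y⟫ + b) x = |⟪w, x⟫ + b| / ‖w‖ := by
  have hn : 0 < ‖w‖ := norm_pos_iff.mpr hw
  refine IsLeast.csInf_eq ⟨⟨(-(⟪w, x⟫ + b) / ‖w‖ ^ 2) • w, ?_, ?_⟩, ?_⟩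
  · rw [norm_smul, Real.norm_eq_abs, abs_div, abs_neg, abs_of_pos (pow_pos hn 2)]
    field_simp
  · have h : ⟪w, x + (-(⟪w, x⟫ + b) / ‖w‖ ^ 2) • w⟫ + b = 0 := by
      rw [inner_add_right, real_inner_smul_right, real_inner_self_eq_norm_sq]
      field_simp
      ring
    simp only [h, mul_zero, le_refl]
  · rintro t ⟨r, rfl, hr⟩
    rw [div_le_iff₀ hn, mul_comm]
    have hcs := abs_le.mp (abs_real_inner_le_norm w r)
    simp only [inner_add_right] at hr
    rw [abs_le]
    constructor <;> by_contra! h <;>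
      nlinarith [mul_nonneg (norm_nonneg w) (norm_nonneg r)]

/-- If `|h| ≤ C` almost everywhere and `h` is nonnegative off `s`, then replacing `h` by `|h|`
increases the integral by at most `2 * C * ν s`. -/
theorem integral_abs_le_integral_add_measureReal {α : Type*} [MeasurableSpace α] {ν : Measure α}
    [IsFiniteMeasure ν] {h : α → ℝ} {C : ℝ} {s : Set α} (hi : Integrable h ν)
    (hC : ∀ᵐ x ∂ν, |h x| ≤ C) (hs : MeasurableSet s) (hpos : ∀ x ∉ s, 0 ≤ h x) :
    ∫ x, |h x| ∂ν ≤ ∫ x, h x ∂ν + 2 * C * (ν s).toReal := by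
  have hind : Integrable (s.indicator fun _ => 2 * C) ν := (integrable_const _).indicator hs
  have hval : ∫ x, s.indicator (fun _ => 2 * C) x ∂ν = 2 * C * (ν s).toReal := by
    rw [integral_indicator_const _ hs, smul_eq_mul, mul_comm, Measure.real]
  rw [← hval, ← integral_add hi hind]
  refine integral_mono_ae hi.abs (hi.add hind) ?_
  filter_upwards [hC] with x hx
  by_cases hxs : x ∈ s
  · simp only [Set.indicator_of_mem hxs]
    linarith [(abs_le.mp hx).1]
  · simp only [Set.indicator_of_notMem hxs, abs_of_nonneg (hpos x hxs), add_zero, le_refl]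

theorem integrable_affine {d : ℕ} (w : EuclideanSpace ℝ (Fin d)) (b : ℝ)
    {ν : Measure (EuclideanSpace ℝ (Fin d))} [IsFiniteMeasure ν]
    (hν : Integrable (fun x : EuclideanSpace ℝ (Fin d) => x) ν) :
    Integrable (fun x => (⟪w, x⟫ + b) / ‖w‖) ν :=
  ((hν.const_inner w).add (integrable_const b)).div_const _

theorem integral_affine {d : ℕ} (w : EuclideanSpace ℝ (Fin d)) (b : ℝ)
    {ν : Measure (EuclideanSpace ℝ (Fin d))} [IsProbabilityMeasure ν]
    (hν : Integrable (fun x : EuclideanSpace ℝ (Fin d) => x) ν) :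
    ∫ x, (⟪w, x⟫ + b) / ‖w‖ ∂ν = (⟪w, ∫ x, x ∂ν⟫ + b) / ‖w‖ := by
  rw [integral_div, integral_add (hν.const_inner w) (integrable_const b), integral_inner hν]
  simp

theorem ae_abs_affine_le {d : ℕ} {w : EuclideanSpace ℝ (Fin d)} (hw : w ≠ 0) {b M : ℝ}
    (hb : |b| ≤ M * ‖w‖) {ν : Measure (EuclideanSpace ℝ (Fin d))}
    (hν : ν (Metric.closedBall (0 : EuclideanSpace ℝ (Fin d)) M)ᶜ = 0) :
    ∀ᵐ x ∂ν, |(⟪w, x⟫ + b) / ‖w‖| ≤ 2 * M := by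
  have hn : 0 < ‖w‖ := norm_pos_iff.mpr hw
  filter_upwards [mem_ae_iff.mpr hν] with x hx
  rw [mem_closedBall_zero_iff] at hx
  rw [abs_div, abs_norm, div_le_iff₀ hn]
  have h1 := abs_real_inner_le_norm w x
  have h2 := abs_add_le ⟪w, x⟫ b
  nlinarith

/-- **Theorem 1, Eq. (6) (adversarial robustness of linear classifiers).**
For `f(x) = wᵀx + b` with `w ≠ 0`, `|b| ≤ M‖w‖₂`, and data distribution
`μ = p₁ μ₁ + p₋₁ μ₋₁` supported on the ball of radius `M`,
`ρ_adv(f) ≤ ‖p₁ E_{μ₁}[x] − p₋₁ E_{μ₋₁}[x]‖₂ + M (|p₁ − p₋₁| + 4 R(f))`. -/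
theorem linear_adv_robustness_upper_bound {d : ℕ}
    (w : EuclideanSpace ℝ (Fin d)) (hw : w ≠ 0) (b M : ℝ) (hM : 0 < M)
    (hb : |b| ≤ M * ‖w‖)
    (p1 pm1 : ℝ) (hp1 : 0 ≤ p1) (hpm1 : 0 ≤ pm1) (hsum : p1 + pm1 = 1)
    (μ1 μm1 : Measure (EuclideanSpace ℝ (Fin d)))
    [IsProbabilityMeasure μ1] [IsProbabilityMeasure μm1]
    (hs1 : μ1 (Metric.closedBall (0 : EuclideanSpace ℝ (Fin d)) M)ᶜ = 0)
    (hsm1 : μm1 (Metric.closedBall (0 : EuclideanSpace ℝ (Fin d)) M)ᶜ = 0)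
    (hmean1 : Integrable (fun x : EuclideanSpace ℝ (Fin d) => x) μ1)
    (hmeanm1 : Integrable (fun x : EuclideanSpace ℝ (Fin d) => x) μm1)
    (μ : Measure (EuclideanSpace ℝ (Fin d)))
    (hμ : μ = ENNReal.ofReal p1 • μ1 + ENNReal.ofReal pm1 • μm1) :
    ∫ x, deltaAdv (fun y => ⟪w, y⟫ + b) x ∂μ ≤
      ‖p1 • (∫ x, x ∂μ1) - pm1 • (∫ x, x ∂μm1)‖ +
        M * (|p1 - pm1| +
          4 * (p1 * (μ1 {x | ⟪w, x⟫ + b < 0}).toReal +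
               pm1 * (μm1 {x | 0 ≤ ⟪w, x⟫ + b}).toReal)) := by
  have hn : 0 < ‖w‖ := norm_pos_iff.mpr hw
  have hi1 := integrable_affine w b hmean1
  have him1 := integrable_affine w b hmeanm1
  have hmeas : Measurable fun x : EuclideanSpace ℝ (Fin d) => ⟪w, x⟫ + b := by fun_prop
  have h1 := integral_abs_le_integral_add_measureReal (s := {x | ⟪w, x⟫ + b < 0}) hi1
    (ae_abs_affine_le hw hb hs1) (measurableSet_lt hmeas measurable_const)
    (fun x hx => div_nonneg (not_lt.mp hx) hn.le)
  have hm1 := integral_abs_le_integral_add_measureReal (s := {x | 0 ≤ ⟪w, x⟫ + b}) him1.neg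
    (by simpa only [Pi.neg_apply, abs_neg] using ae_abs_affine_le hw hb hsm1)
    (measurableSet_le measurable_const hmeas)
    (fun x hx => neg_nonneg.mpr (div_nonpos_of_nonpos_of_nonneg (not_le.mp hx).le hn.le))
  simp only [Pi.neg_apply, abs_neg, integral_neg] at hm1
  rw [integral_affine w b hmean1] at h1
  rw [integral_affine w b hmeanm1] at hm1
  have hΔ : ∀ x, deltaAdv (fun y => ⟪w, y⟫ + b) x = |(⟪w, x⟫ + b) / ‖w‖| := fun x => by
    rw [deltaAdv_affine hw, abs_div, abs_norm]
  simp only [hΔ]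
  rw [hμ, integral_add_measure (hi1.abs.smul_measure ENNReal.ofReal_ne_top)
    (him1.abs.smul_measure ENNReal.ofReal_ne_top), integral_smul_measure, integral_smul_measure,
    ENNReal.toReal_ofReal hp1, ENNReal.toReal_ofReal hpm1, smul_eq_mul, smul_eq_mul]
  have hmain : p1 * ((⟪w, ∫ x, x ∂μ1⟫ + b) / ‖w‖) - pm1 * ((⟪w, ∫ x, x ∂μm1⟫ + b) / ‖w‖) ≤
      ‖p1 • (∫ x, x ∂μ1) - pm1 • (∫ x, x ∂μm1)‖ + M * |p1 - pm1| := by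
    have hcs := real_inner_le_norm w (p1 • (∫ x, x ∂μ1) - pm1 • (∫ x, x ∂μm1))
    rw [inner_sub_right, real_inner_smul_right, real_inner_smul_right] at hcs
    have hbp : (p1 - pm1) * b ≤ |p1 - pm1| * (M * ‖w‖) :=
      (le_abs_self _).trans ((abs_mul _ _).trans_le (by gcongr))
    rw [← mul_div_assoc, ← mul_div_assoc, ← sub_div, div_le_iff₀ hn]
    linarith
  linarith [mul_le_mul_of_nonneg_left h1 hp1, mul_le_mul_of_nonneg_left hm1 hpm1]
end

section
/- Let f(x) = wᵀx be a linear classifier on ℝ^d with w ≠ 0 (intercept b = 0). Let μ = (1/2) μ₁ + (1/2) μ₋₁ be a probability measure supported on the ball B = {x : ‖x‖₂ ≤ M}, where μ₁, μ₋₁ are class-conditional probability measures (balanced classes p₁ = p₋₁ = 1/2), and assume the means E_{μ₁}[x], E_{μ₋₁}[x] exist. Then ρ_adv(f) ≤ (1/2) ‖E_{μ₁}[x] − E_{μ₋₁}[x]‖₂ + 2 M R(f). -/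
open MeasureTheory Metric
open scoped RealInnerProductSpace ENNReal

theorem deltaAdv_nonneg {d : ℕ} (f : EuclideanSpace ℝ (Fin d) → ℝ)
    (x : EuclideanSpace ℝ (Fin d)) : 0 ≤ deltaAdv f x := by
  refine Real.sInf_nonneg ?_
  rintro t ⟨r, rfl, -⟩
  exact norm_nonneg r

/-- The distance from `x` to the hyperplane `wᵀy = 0` bounds the robustness of `wᵀy` at `x`. -/
theorem deltaAdv_inner_le {d : ℕ} {w : EuclideanSpace ℝ (Fin d)} (hw : w ≠ 0)
    (x : EuclideanSpace ℝ (Fin d)) :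
    deltaAdv (fun y => ⟪w, y⟫) x ≤ |⟪‖w‖⁻¹ • w, x⟫| := by
  have hw' : ‖w‖ ≠ 0 := norm_ne_zero_iff.mpr hw
  refine csInf_le ⟨0, ?_⟩ ⟨-((⟪w, x⟫ / ‖w‖ ^ 2) • w), ?_, ?_⟩
  · rintro t ⟨r, rfl, -⟩
    exact norm_nonneg r
  · rw [norm_neg, norm_smul, real_inner_smul_left, Real.norm_eq_abs, abs_div, abs_mul,
      abs_inv, abs_norm, abs_of_nonneg (sq_nonneg ‖w‖)]
    field_simp
  · have h : ⟪w, x + -((⟪w, x⟫ / ‖w‖ ^ 2) • w)⟫ = 0 := by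
      rw [inner_add_right, inner_neg_right, real_inner_smul_right, real_inner_self_eq_norm_sq]
      field_simp
      ring
    simp only [h, mul_zero, le_refl]

/-- If `⟪u, x⟫` is nonnegative off `S`, the first absolute moment of `⟪u, x⟫` exceeds its mean
by at most `2 M ν(S)`. -/
theorem integral_abs_inner_le {E : Type*} [NormedAddCommGroup E] [InnerProductSpace ℝ E]
    [CompleteSpace E] [MeasurableSpace E] {ν : Measure E} [IsFiniteMeasure ν] {M : ℝ}
    (hs : ν (Metric.closedBall (0 : E) M)ᶜ = 0) (hint : Integrable (fun x : E => x) ν)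
    {u : E} (hu : ‖u‖ ≤ 1) {S : Set E} (hS : MeasurableSet S) (hpos : ∀ x ∉ S, 0 ≤ ⟪u, x⟫) :
    ∫ x, |⟪u, x⟫| ∂ν ≤ ⟪u, ∫ x, x ∂ν⟫ + 2 * M * (ν S).toReal := by
  have hg : Integrable (fun x : E => ⟪u, x⟫) ν := hint.const_inner u
  have hi : Integrable (S.indicator fun _ : E => 2 * M) ν :=
    (integrable_const (2 * M)).indicator hS
  have hle : (fun x : E => |⟪u, x⟫|) ≤ᵐ[ν]
      fun x => ⟪u, x⟫ + S.indicator (fun _ => 2 * M) x := by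
    have hball : ∀ᵐ x ∂ν, x ∈ Metric.closedBall (0 : E) M := hs
    filter_upwards [hball] with x hx
    by_cases hxS : x ∈ S
    · rw [Set.indicator_of_mem hxS]
      have hxM : ‖x‖ ≤ M := by simpa using hx
      have hb : |⟪u, x⟫| ≤ M := by
        have h1 := abs_real_inner_le_norm u x
        have h2 := mul_le_mul_of_nonneg_right hu (norm_nonneg x)
        linarith
      linarith [neg_abs_le ⟪u, x⟫]
    · rw [Set.indicator_of_notMem hxS, add_zero, abs_of_nonneg (hpos x hxS)]
  calc ∫ x, |⟪u, x⟫| ∂ν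
      ≤ ∫ x, (⟪u, x⟫ + S.indicator (fun _ => 2 * M) x) ∂ν :=
        integral_mono_ae hg.abs (hg.add hi) hle
    _ = ⟪u, ∫ x, x ∂ν⟫ + 2 * M * (ν S).toReal := by
        rw [integral_add hg hi, integral_inner hint, integral_indicator_const _ hS,
          smul_eq_mul, mul_comm (ν.real S), Measure.real]

/-- **Theorem 1, Eq. (7) (balanced case, zero intercept).**
For `f(x) = wᵀx` with `w ≠ 0` and balanced data `μ = ½ μ₁ + ½ μ₋₁` supported on the
ball of radius `M`,
`ρ_adv(f) ≤ ½ ‖E_{μ₁}[x] − E_{μ₋₁}[x]‖₂ + 2 M R(f)`. -/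
theorem linear_adv_robustness_upper_bound_balanced {d : ℕ}
    (w : EuclideanSpace ℝ (Fin d)) (hw : w ≠ 0) (M : ℝ) (hM : 0 < M)
    (μ1 μm1 : Measure (EuclideanSpace ℝ (Fin d)))
    [IsProbabilityMeasure μ1] [IsProbabilityMeasure μm1]
    (hs1 : μ1 (Metric.closedBall (0 : EuclideanSpace ℝ (Fin d)) M)ᶜ = 0)
    (hsm1 : μm1 (Metric.closedBall (0 : EuclideanSpace ℝ (Fin d)) M)ᶜ = 0)
    (hmean1 : Integrable (fun x : EuclideanSpace ℝ (Fin d) => x) μ1)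
    (hmeanm1 : Integrable (fun x : EuclideanSpace ℝ (Fin d) => x) μm1)
    (μ : Measure (EuclideanSpace ℝ (Fin d)))
    (hμ : μ = (1 / 2 : ℝ≥0∞) • μ1 + (1 / 2 : ℝ≥0∞) • μm1) :
    ∫ x, deltaAdv (fun y => ⟪w, y⟫) x ∂μ ≤
      (1 / 2) * ‖(∫ x, x ∂μ1) - (∫ x, x ∂μm1)‖ +
        2 * M * ((1 / 2) * (μ1 {x | ⟪w, x⟫ < 0}).toReal +
                 (1 / 2) * (μm1 {x | 0 ≤ ⟪w, x⟫}).toReal) := by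
  have hw' : 0 < ‖w‖ := norm_pos_iff.mpr hw
  set u := ‖w‖⁻¹ • w with hu_def
  have hu : ‖u‖ = 1 := norm_smul_inv_norm hw
  have hux : ∀ x, ⟪u, x⟫ = ‖w‖⁻¹ * ⟪w, x⟫ := fun x => real_inner_smul_left _ _ _
  have hmeas : Measurable fun x : EuclideanSpace ℝ (Fin d) => ⟪w, x⟫ := by fun_prop
  have h1 := integral_abs_inner_le hs1 hmean1 hu.le
    (measurableSet_lt hmeas measurable_const : MeasurableSet {x | ⟪w, x⟫ < 0})
    (fun x hx => by
      rw [hux]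
      exact mul_nonneg (inv_nonneg.mpr hw'.le) (not_lt.mp hx))
  have h2 := integral_abs_inner_le hsm1 hmeanm1 (u := -u) (by rw [norm_neg, hu])
    (measurableSet_le measurable_const hmeas : MeasurableSet {x | 0 ≤ ⟪w, x⟫})
    (fun x hx => by
      rw [inner_neg_left, hux, ← mul_neg]
      exact mul_nonneg (inv_nonneg.mpr hw'.le) (neg_nonneg.mpr (not_le.mp hx).le))
  simp only [inner_neg_left, abs_neg] at h2
  have hi1 : Integrable (fun x => |⟪u, x⟫|) ((1 / 2 : ℝ≥0∞) • μ1) :=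
    (hmean1.const_inner u).abs.smul_measure (by simp)
  have hi2 : Integrable (fun x => |⟪u, x⟫|) ((1 / 2 : ℝ≥0∞) • μm1) :=
    (hmeanm1.const_inner u).abs.smul_measure (by simp)
  have hμint : ∫ x, |⟪u, x⟫| ∂μ =
      (1 / 2) * ∫ x, |⟪u, x⟫| ∂μ1 + (1 / 2) * ∫ x, |⟪u, x⟫| ∂μm1 := by
    rw [hμ, integral_add_measure hi1 hi2, integral_smul_measure, integral_smul_measure]
    simp
  have hle : ∫ x, deltaAdv (fun y => ⟪w, y⟫) x ∂μ ≤ ∫ x, |⟪u, x⟫| ∂μ :=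
    integral_mono_of_nonneg (Filter.Eventually.of_forall fun x => deltaAdv_nonneg _ x)
      (hμ ▸ hi1.add_measure hi2) (Filter.Eventually.of_forall (deltaAdv_inner_le hw))
  have hcs := real_inner_le_norm u ((∫ x, x ∂μ1) - ∫ x, x ∂μm1)
  rw [hu, one_mul, inner_sub_right] at hcs
  linarith
end

section
/- Let f(x) = wᵀx + b be a linear classifier on ℝ^d with w ≠ 0, let μ be a probability measure on ℝ^d such that Δ_adv(·;f) and Δ_unif,ε(·;f) are μ-integrable, and let ε ∈ (0, 1/12). Then ρ_unif,ε(f) ≤ C̃₂(ε,d) · ρ_adv(f) ≤ C₂(ε) √d · ρ_adv(f), where C̃₂(ε,d) = (1 − (12ε)^{1/d})^{−1/2} and C₂(ε) = (1 − 12ε)^{−1/2}. -/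
open MeasureTheory Metric
open scoped RealInnerProductSpace ENNReal

/-- The uniform (rotation-invariant) probability measure on the sphere of radius `η`
centered at `0` in `ℝ^d`, viewed as a measure on the ambient space. -/
noncomputable def unifSphere (d : ℕ) (η : ℝ) : Measure (EuclideanSpace ℝ (Fin d)) :=
  ((volume : Measure (EuclideanSpace ℝ (Fin d))).toSphere Set.univ)⁻¹ •
    Measure.map
      (fun z : Metric.sphere (0 : EuclideanSpace ℝ (Fin d)) 1 =>
        η • (z : EuclideanSpace ℝ (Fin d)))
      (volume : Measure (EuclideanSpace ℝ (Fin d))).toSphere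

/-- Robustness to random uniform noise at `x`:
`Δ_unif,ε(x; f) = sup {η ≥ 0 : P_{n ~ η𝕊}(f(x) f(x+n) ≤ 0) ≤ ε}`. -/
noncomputable def deltaUnif {d : ℕ} (f : EuclideanSpace ℝ (Fin d) → ℝ) (ε : ℝ)
    (x : EuclideanSpace ℝ (Fin d)) : ℝ :=
  sSup {η : ℝ | 0 ≤ η ∧
    unifSphere d η {n | f x * f (x + n) ≤ 0} ≤ ENNReal.ofReal ε}

section CapBound

open Module Set
open scoped Pointwise

variable {E : Type*} [NormedAddCommGroup E] [InnerProductSpace ℝ E] [FiniteDimensional ℝ E]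
  [MeasurableSpace E] [BorelSpace E]

theorem integral_ball_norm_sq [Nontrivial E] :
    ∫ y in ball (0 : E) 1, ‖y‖ ^ 2 =
      (finrank ℝ E : ℝ) / (finrank ℝ E + 2) * volume.real (ball (0 : E) 1) := by
  have h1 : ∫ y in ball (0 : E) 1, ‖y‖ ^ 2 =
      ∫ y : E, (Iio (1 : ℝ)).indicator (fun r => r ^ 2) ‖y‖ := by
    rw [← integral_indicator measurableSet_ball]
    congr with y
    simp [indicator]
  have hn : 0 < finrank ℝ E := finrank_pos
  have h2 : ∫ r in Ioi (0 : ℝ), r ^ (finrank ℝ E - 1) • (Iio (1 : ℝ)).indicator (fun r => r ^ 2) r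
      = 1 / (finrank ℝ E + 2) := by
    have : ∀ r : ℝ, r ^ (finrank ℝ E - 1) • (Iio (1 : ℝ)).indicator (fun r => r ^ 2) r =
        (Iio (1 : ℝ)).indicator (fun r => r ^ (finrank ℝ E + 1)) r := by
      intro r
      by_cases hr : r < 1
      · simp only [indicator, mem_Iio, hr, if_true, smul_eq_mul, ← pow_add]
        congr 1
        omega
      · simp [indicator, hr]
    simp_rw [this]
    rw [setIntegral_indicator measurableSet_Iio, Ioi_inter_Iio, ← integral_Ioc_eq_integral_Ioo,
      ← intervalIntegral.integral_of_le zero_le_one, integral_pow]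
    push_cast
    simp
    ring
  rw [h1, integral_fun_norm_addHaar, h2]
  simp only [nsmul_eq_mul, smul_eq_mul]
  ring

theorem integrableOn_ball_inner_sq (u : E) :
    IntegrableOn (fun y => ⟪u, y⟫ ^ 2) (ball (0 : E) 1) :=
  ((by fun_prop : Continuous fun y : E => ⟪u, y⟫ ^ 2).continuousOn.integrableOn_compact
    (isCompact_closedBall (0 : E) 1)).mono_set ball_subset_closedBall

theorem integral_ball_inner_sq_eq_of_norm_eq {u v : E} (h : ‖u‖ = ‖v‖) :
    ∫ y in ball (0 : E) 1, ⟪u, y⟫ ^ 2 = ∫ y in ball (0 : E) 1, ⟪v, y⟫ ^ 2 := by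
  set T : E ≃ₗᵢ[ℝ] E := (ℝ ∙ (u - v))ᗮ.reflection with hT
  have hTu : T u = v := Submodule.reflection_sub h
  have hpre : T ⁻¹' ball (0 : E) 1 = ball 0 1 := by
    ext y
    simp
  have := T.measurePreserving.setIntegral_preimage_emb
    T.toHomeomorph.measurableEmbedding (fun y => ⟪v, y⟫ ^ 2) (ball (0 : E) 1)
  rw [← this, hpre, ← hTu]
  simp

theorem integral_ball_inner_sq {u : E} (hu : ‖u‖ = 1) :
    ∫ y in ball (0 : E) 1, ⟪u, y⟫ ^ 2 =
      1 / (finrank ℝ E + 2) * volume.real (ball (0 : E) 1) := by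
  have : Nontrivial E := ⟨⟨u, 0, by rintro rfl; simp at hu⟩⟩
  have hn : (0 : ℝ) < finrank ℝ E := by exact_mod_cast finrank_pos
  have b := stdOrthonormalBasis ℝ E
  have key : (finrank ℝ E : ℝ) * ∫ y in ball (0 : E) 1, ⟪u, y⟫ ^ 2 =
      ∫ y in ball (0 : E) 1, ‖y‖ ^ 2 := by
    simp_rw [← b.sum_sq_inner_right]
    rw [integral_finsetSum _ fun i _ => integrableOn_ball_inner_sq (b i),
      Finset.sum_congr rfl fun i _ =>
        integral_ball_inner_sq_eq_of_norm_eq (v := u) (by rw [b.norm_eq_one, hu])]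
    simp
  rw [integral_ball_norm_sq] at key
  apply mul_left_cancel₀ hn.ne'
  rw [key]
  ring

theorem volume_ball_le_four_mul_slab {u : E} (hu : ‖u‖ = 1) {κ : ℝ} (hκ : 0 ≤ κ)
    (hκ2 : κ ^ 2 = 2 / (finrank ℝ E + 2)) :
    volume.real (ball (0 : E) 1) ≤
      4 * volume.real {y ∈ ball (0 : E) 1 | 0 ≤ ⟪u, y⟫ ∧ ⟪u, y⟫ ≤ κ} := by
  set B := ball (0 : E) 1
  set S := {y ∈ B | 0 ≤ ⟪u, y⟫ ∧ ⟪u, y⟫ ≤ κ} with hS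
  set T := {y ∈ B | κ ^ 2 ≤ ⟪u, y⟫ ^ 2} with hT
  have hBfin : volume B ≠ ⊤ := measure_ball_lt_top.ne
  have hfin : ∀ {A : Set E}, A ⊆ B → volume A ≠ ⊤ := fun h => measure_ne_top_of_subset h hBfin
  have hSB : S ⊆ B := sep_subset _ _
  have hnegB : -S ⊆ B := fun y hy => by simpa [B] using hSB hy
  have hTB : T ⊆ B := sep_subset _ _
  have hcover : B ⊆ (S ∪ -S) ∪ T := by
    intro y hy
    by_cases h : κ ^ 2 ≤ ⟪u, y⟫ ^ 2
    · exact Or.inr ⟨hy, h⟩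
    · left
      have h' := abs_lt_of_sq_lt_sq (not_le.mp h) hκ
      rcases le_total 0 ⟪u, y⟫ with h0 | h0
      · exact Or.inl ⟨hy, h0, (abs_lt.mp (by simpa using h')).2.le⟩
      · refine Or.inr ⟨by simpa [B] using hy, ?_, ?_⟩
        · simpa using h0
        · have := (abs_lt.mp (by simpa using h')).1
          rw [inner_neg_right]
          linarith
  have hneg : volume.real (-S) = volume.real S := by
    simp [measureReal_def, Measure.measure_neg]
  have hunion : volume.real B ≤ volume.real S + volume.real S + volume.real T := by
    calc volume.real B ≤ volume.real ((S ∪ -S) ∪ T) :=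
          measureReal_mono hcover (hfin (union_subset (union_subset hSB hnegB) hTB))
      _ ≤ volume.real (S ∪ -S) + volume.real T := measureReal_union_le _ _
      _ ≤ _ := by
        have := measureReal_union_le (μ := volume) S (-S)
        rw [hneg] at this
        linarith
  have hmarkov : κ ^ 2 * volume.real T ≤ 1 / (finrank ℝ E + 2) * volume.real B := by
    have h := mul_meas_ge_le_integral_of_nonneg (μ := volume.restrict B)
      (f := fun y => ⟪u, y⟫ ^ 2) (ae_of_all _ fun y => sq_nonneg _)
      (integrableOn_ball_inner_sq u) (κ ^ 2)
    rw [integral_ball_inner_sq hu, measureReal_restrict_apply' measurableSet_ball] at h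
    convert h using 3
    ext y
    simp [hT, and_comm, B]
  have hn : (0 : ℝ) < (finrank ℝ E : ℝ) + 2 := by positivity
  rw [hκ2, div_mul_eq_mul_div, div_mul_eq_mul_div, div_le_div_iff_of_pos_right hn] at hmarkov
  linarith

theorem one_third_le_sqrt_pow (n : ℕ) : 1 / 3 ≤ √((n : ℝ) / (n + 2)) ^ n := by
  rcases Nat.eq_zero_or_pos n with rfl | hn
  · norm_num
  have hn' : (0 : ℝ) < n := by exact_mod_cast hn
  have hA : 0 ≤ √((n : ℝ) / (n + 2)) ^ n := by positivity
  have h1 : (1 + 2 / (n : ℝ)) ^ n ≤ 9 := by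
    calc (1 + 2 / (n : ℝ)) ^ n ≤ (Real.exp (2 / n)) ^ n := by
          gcongr
          linarith [Real.add_one_le_exp (2 / (n : ℝ))]
      _ = Real.exp 1 ^ 2 := by
          rw [← Real.exp_nat_mul, ← Real.exp_nat_mul]
          congr 1
          push_cast
          field_simp
      _ ≤ 3 ^ 2 := by
          gcongr
          linarith [Real.exp_one_lt_d9]
      _ = 9 := by norm_num
  have h2 : (√((n : ℝ) / (n + 2)) ^ n) ^ 2 * (1 + 2 / (n : ℝ)) ^ n = 1 := by
    rw [← pow_mul, mul_comm n 2, pow_mul, Real.sq_sqrt (by positivity), ← mul_pow]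
    have : (n : ℝ) / (n + 2) * (1 + 2 / n) = 1 := by field_simp
    rw [this, one_pow]
  by_contra! h
  have h3 : (√((n : ℝ) / (n + 2)) ^ n) ^ 2 < 1 / 9 := by nlinarith
  have h4 : 0 < (1 + 2 / (n : ℝ)) ^ n := by positivity
  nlinarith [sq_nonneg (√((n : ℝ) / (n + 2)) ^ n)]

/-- The cap of height `t` has normalized measure at least `(1 - t²) ^ n / 12`. -/
theorem toSphere_cap_ge {u : E} (hu : ‖u‖ = 1) {t : ℝ} (ht0 : 0 < t) (ht1 : t < 1) :
    ENNReal.ofReal ((1 - t ^ 2) ^ finrank ℝ E / 12) * (volume : Measure E).toSphere univ ≤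
      (volume : Measure E).toSphere {z : sphere (0 : E) 1 | t ≤ ⟪u, (z : E)⟫} := by
  have hmeas : MeasurableSet {z : sphere (0 : E) 1 | t ≤ ⟪u, (z : E)⟫} :=
    measurableSet_le measurable_const (by fun_prop)
  rw [Measure.toSphere_apply' _ hmeas, Measure.toSphere_apply_univ, mul_left_comm]
  gcongr
  set n := finrank ℝ E
  set q := 1 - t ^ 2
  have hq : 0 < q := by simp only [q]; nlinarith
  set A := √((n : ℝ) / (n + 2))
  have : Nontrivial E := ⟨⟨u, 0, by rintro rfl; simp at hu⟩⟩
  have hn : (0 : ℝ) < n := by exact_mod_cast finrank_pos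
  have hA : 0 < A := by positivity
  have hA2 : A ^ 2 = n / (n + 2) := Real.sq_sqrt (by positivity)
  set κ := √(2 / ((n : ℝ) + 2))
  have hκ : 0 ≤ κ := by positivity
  have hκ2 : κ ^ 2 = 2 / ((n : ℝ) + 2) := Real.sq_sqrt (by positivity)
  have hAκ : A ^ 2 + κ ^ 2 = 1 := by rw [hA2, hκ2]; field_simp
  set S := {y ∈ ball (0 : E) 1 | 0 ≤ ⟪u, y⟫ ∧ ⟪u, y⟫ ≤ κ} with hS
  set r := q * A
  have hr : 0 < r := by positivity
  have hbound : t ^ 2 + 2 * t * r * κ + r ^ 2 ≤ 1 := by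
    have h1 : q * A ^ 2 + 2 * t * A * κ ≤ 1 := by
      simp only [q]
      nlinarith [sq_nonneg (t * A - κ)]
    have h2 := mul_le_mul_of_nonneg_left h1 hq.le
    simp only [r]
    have h3 : t ^ 2 = 1 - q := by simp [q]
    nlinarith
  have hsub : (fun x => t • u + x) '' (r • S) ⊆
      Ioo (0 : ℝ) 1 • ((↑) '' {z : sphere (0 : E) 1 | t ≤ ⟪u, (z : E)⟫}) := by
    rintro _ ⟨_, ⟨y, ⟨hyB, hy0, hyκ⟩, rfl⟩, rfl⟩
    set x := t • u + r • y with hx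
    have hux : ⟪u, x⟫ = t + r * ⟪u, y⟫ := by
      rw [hx, inner_add_right, inner_smul_right, inner_smul_right, real_inner_self_eq_norm_sq, hu]
      ring
    have htx : t ≤ ⟪u, x⟫ := by rw [hux]; nlinarith [mul_nonneg hr.le hy0]
    have hx0 : 0 < ‖x‖ := by
      rw [norm_pos_iff]
      intro h
      rw [h, inner_zero_right] at htx
      linarith
    have hxsq : ‖x‖ ^ 2 < 1 := by
      have hy1 : ‖y‖ < 1 := by simpa using hyB
      have : ‖x‖ ^ 2 = t ^ 2 + 2 * (t * (r * ⟪u, y⟫)) + r ^ 2 * ‖y‖ ^ 2 := by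
        rw [hx, norm_add_sq_real, inner_smul_left, inner_smul_right, norm_smul, norm_smul, hu,
          mul_pow, mul_pow]
        simp
      have h1 : t * (r * ⟪u, y⟫) ≤ t * (r * κ) := by gcongr
      have h2 : r ^ 2 * ‖y‖ ^ 2 < r ^ 2 * 1 := by
        gcongr
        nlinarith [norm_nonneg y]
      nlinarith
    have hx1 : ‖x‖ < 1 := by nlinarith
    refine ⟨‖x‖, ⟨hx0, hx1⟩, ‖x‖⁻¹ • x, ⟨⟨‖x‖⁻¹ • x, ?_⟩, ?_, rfl⟩, ?_⟩
    · simp [norm_smul, hx0.ne']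
    · change t ≤ ⟪u, ‖x‖⁻¹ • x⟫
      rw [inner_smul_right, ← div_eq_inv_mul, le_div_iff₀ hx0]
      nlinarith
    · exact smul_inv_smul₀ hx0.ne' x
  refine le_trans ?_ (measure_mono hsub)
  rw [image_add_left, measure_preimage_add, Measure.addHaar_smul_of_nonneg _ hr.le]
  have hslab := volume_ball_le_four_mul_slab hu hκ hκ2
  have hSfin : volume S ≠ ⊤ := measure_ne_top_of_subset (sep_subset _ _) measure_ball_lt_top.ne
  have hslab' : volume (ball (0 : E) 1) ≤ ENNReal.ofReal 4 * volume S := by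
    rw [← ofReal_measureReal measure_ball_lt_top.ne, ← ofReal_measureReal hSfin,
      ← ENNReal.ofReal_mul (by norm_num)]
    exact ENNReal.ofReal_le_ofReal hslab
  calc ENNReal.ofReal (q ^ n / 12) * volume (ball (0 : E) 1)
      ≤ ENNReal.ofReal (q ^ n / 12) * (ENNReal.ofReal 4 * volume S) := by gcongr
    _ = ENNReal.ofReal (q ^ n / 12 * 4) * volume S := by
      rw [← mul_assoc, ← ENNReal.ofReal_mul (by positivity)]
    _ ≤ ENNReal.ofReal (r ^ n) * volume S := by
      gcongr
      have := mul_le_mul_of_nonneg_left (one_third_le_sqrt_pow n) (pow_pos hq n).le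
      simp only [r, mul_pow]
      linarith

end CapBound

/-- The distance from `x` to the decision boundary bounds `deltaAdv` from below. -/
theorem abs_div_norm_le_deltaAdv {d : ℕ} {w : EuclideanSpace ℝ (Fin d)} (hw : w ≠ 0) (b : ℝ)
    (x : EuclideanSpace ℝ (Fin d)) :
    |⟪w, x⟫ + b| / ‖w‖ ≤ deltaAdv (fun y => ⟪w, y⟫ + b) x := by
  have hw' : 0 < ‖w‖ := norm_pos_iff.mpr hw
  refine le_csInf ⟨_, -((⟪w, x⟫ + b) / ‖w‖ ^ 2) • w, rfl, ?_⟩ ?_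
  · simp only [inner_add_right, inner_smul_right, real_inner_self_eq_norm_sq]
    rw [neg_mul, div_mul_cancel₀ _ (by positivity)]
    nlinarith
  · rintro _ ⟨r, rfl, h⟩
    rw [div_le_iff₀ hw', mul_comm]
    refine le_trans ?_ (abs_real_inner_le_norm w r)
    simp only [inner_add_right] at h
    rcases le_total 0 (⟪w, x⟫ + b) with h0 | h0
    · rw [abs_of_nonneg h0]
      rcases h0.eq_or_lt with h1 | h1
      · rw [← h1]; positivity
      · have : ⟪w, x⟫ + ⟪w, r⟫ + b ≤ 0 := nonpos_of_mul_nonpos_right h h1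
        linarith [neg_le_abs ⟪w, r⟫]
    · rw [abs_of_nonpos h0]
      rcases h0.eq_or_lt with h1 | h1
      · rw [h1]; simp
      · have : 0 ≤ ⟪w, x⟫ + ⟪w, r⟫ + b := by
          by_contra! h2
          nlinarith [mul_pos_of_neg_of_neg h1 h2]
        linarith [le_abs_self ⟪w, r⟫]

theorem unifSphere_apply {d : ℕ} (η : ℝ) {s : Set (EuclideanSpace ℝ (Fin d))}
    (hs : MeasurableSet s) :
    unifSphere d η s = ((volume : Measure (EuclideanSpace ℝ (Fin d))).toSphere Set.univ)⁻¹ *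
      (volume : Measure (EuclideanSpace ℝ (Fin d))).toSphere
        {z | η • (z : EuclideanSpace ℝ (Fin d)) ∈ s} := by
  rw [unifSphere, Measure.smul_apply, Measure.map_apply (by fun_prop) hs, smul_eq_mul]
  rfl

theorem le_unifSphere_flip {d : ℕ} (hd : 0 < d) {w : EuclideanSpace ℝ (Fin d)} (hw : w ≠ 0)
    (b : ℝ) (x : EuclideanSpace ℝ (Fin d)) {t η : ℝ} (ht0 : 0 < t) (ht1 : t < 1) (hη : 0 < η)
    (htη : |⟪w, x⟫ + b| / ‖w‖ ≤ t * η) :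
    ENNReal.ofReal ((1 - t ^ 2) ^ d / 12) ≤
      unifSphere d η {n | (⟪w, x⟫ + b) * (⟪w, x + n⟫ + b) ≤ 0} := by
  have hw' : 0 < ‖w‖ := norm_pos_iff.mpr hw
  have : Nonempty (Fin d) := ⟨⟨0, hd⟩⟩
  have hmeas : MeasurableSet
      {n : EuclideanSpace ℝ (Fin d) | (⟪w, x⟫ + b) * (⟪w, x + n⟫ + b) ≤ 0} :=
    measurableSet_le (by fun_prop) measurable_const
  have hne : (volume : Measure (EuclideanSpace ℝ (Fin d))).toSphere Set.univ ≠ 0 :=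
    Measure.measure_univ_ne_zero.mpr (Measure.toSphere_ne_zero _)
  rw [unifSphere_apply _ hmeas, mul_comm _⁻¹, ← div_eq_mul_inv,
    ENNReal.le_div_iff_mul_le (Or.inl hne) (Or.inl (measure_ne_top _ _))]
  rw [div_le_iff₀ hw'] at htη
  obtain ⟨σ, hσ, hσa⟩ : ∃ σ : ℝ, |σ| = 1 ∧ σ * |⟪w, x⟫ + b| = -(⟪w, x⟫ + b) := by
    rcases le_total 0 (⟪w, x⟫ + b) with h0 | h0
    · exact ⟨-1, by simp, by rw [abs_of_nonneg h0]; ring⟩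
    · exact ⟨1, by simp, by rw [abs_of_nonpos h0]; ring⟩
  have hσ2 : σ * σ = 1 := by rw [← abs_mul_abs_self, hσ, one_mul]
  have hu : ‖(σ / ‖w‖) • w‖ = 1 := by
    rw [norm_smul, Real.norm_eq_abs, abs_div, hσ, abs_norm]
    field_simp
  have hcap := toSphere_cap_ge hu ht0 ht1
  rw [finrank_euclideanSpace_fin] at hcap
  refine hcap.trans (measure_mono ?_)
  intro z hz
  simp only [Set.mem_ofPred_eq, real_inner_smul_left, inner_add_right, inner_smul_right] at hz ⊢
  set p := ⟪w, (z : EuclideanSpace ℝ (Fin d))⟫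
  set a := ⟪w, x⟫ + b
  rw [div_mul_eq_mul_div, le_div_iff₀ hw'] at hz
  have h1 : |a| ≤ η * (σ * p) := by nlinarith
  have ha : a = -(σ * |a|) := by linarith
  have h2 : a * (⟪w, x⟫ + η * p + b) = |a| * (|a| - η * (σ * p)) := by
    have : ⟪w, x⟫ + η * p + b = a + η * p := by simp only [a]; ring
    rw [this]
    have h3 : a * a = |a| * |a| := (abs_mul_abs_self a).symm
    calc a * (a + η * p) = a * a + a * (η * p) := by ring
      _ = |a| * |a| + -(σ * |a|) * (η * p) := by rw [h3, ← ha]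
      _ = _ := by ring
  rw [h2]
  exact mul_nonpos_of_nonneg_of_nonpos (abs_nonneg _) (by linarith)

theorem deltaUnif_le_mul_deltaAdv {d : ℕ} (hd : 0 < d) {w : EuclideanSpace ℝ (Fin d)}
    (hw : w ≠ 0) (b : ℝ) {ε : ℝ} (hε0 : 0 < ε) (hε : ε < 1 / 12)
    (x : EuclideanSpace ℝ (Fin d)) :
    deltaUnif (fun y => ⟪w, y⟫ + b) ε x ≤
      (1 - (12 * ε) ^ ((d : ℝ)⁻¹)) ^ (-(1 / 2) : ℝ) * deltaAdv (fun y => ⟪w, y⟫ + b) x := by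
  set s := (12 * ε) ^ ((d : ℝ)⁻¹) with hs
  have hd' : (0 : ℝ) < d := by exact_mod_cast hd
  have hs0 : 0 < s := by positivity
  have hs1 : s < 1 := Real.rpow_lt_one (by positivity) (by linarith) (by positivity)
  have hsd : s ^ d = 12 * ε := Real.rpow_inv_natCast_pow (by positivity) hd.ne'
  set D := deltaAdv (fun y => ⟪w, y⟫ + b) x
  have hD0 : 0 ≤ D := deltaAdv_nonneg _ _
  set m := √(1 - s) with hm
  have hm0 : 0 < m := Real.sqrt_pos.mpr (by linarith)
  have hm2 : m ^ 2 = 1 - s := Real.sq_sqrt (by linarith)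
  have hm1 : m < 1 := by nlinarith
  have hC : (1 - s) ^ (-(1 / 2) : ℝ) = m⁻¹ := by
    rw [Real.rpow_neg (by linarith), hm, Real.sqrt_eq_rpow]
  rw [hC]
  refine Real.sSup_le ?_ (by positivity)
  rintro η ⟨hη0, hη⟩
  by_contra! hlt
  have hηpos : 0 < η := lt_of_le_of_lt (by positivity) hlt
  have hDη : D / η < m := by
    rw [div_lt_iff₀ hηpos]
    rwa [inv_mul_lt_iff₀ hm0] at hlt
  obtain ⟨t, ht1, htm⟩ := exists_between hDη
  have ht0 : 0 < t := lt_of_le_of_lt (by positivity) ht1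
  have hflip := le_unifSphere_flip hd hw b x ht0 (htm.trans hm1) hηpos
    ((abs_div_norm_le_deltaAdv hw b x).trans ((div_le_iff₀ hηpos).mp ht1.le))
  have hle := (ENNReal.ofReal_le_ofReal_iff hε0.le).mp (hflip.trans hη)
  have hst : s < 1 - t ^ 2 := by nlinarith
  have := pow_lt_pow_left₀ hst hs0.le hd.ne'
  rw [hsd] at this
  linarith

theorem rpow_neg_half_le_mul_sqrt {d : ℕ} (hd : 0 < d) {c : ℝ} (hc0 : 0 < c) (hc1 : c < 1) :
    (1 - c ^ ((d : ℝ)⁻¹)) ^ (-(1 / 2) : ℝ) ≤ (1 - c) ^ (-(1 / 2) : ℝ) * √d := by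
  set s := c ^ ((d : ℝ)⁻¹) with hs
  have hd' : (0 : ℝ) < d := by exact_mod_cast hd
  have hs0 : 0 < s := by positivity
  have hs1 : s < 1 := Real.rpow_lt_one hc0.le hc1 (by positivity)
  have hsd : s ^ d = c := Real.rpow_inv_natCast_pow hc0.le hd.ne'
  have hbern : 1 - c ≤ d * (1 - s) := by
    have := one_add_mul_sub_le_pow (by linarith : -1 ≤ s) d
    rw [hsd] at this
    linarith
  rw [Real.rpow_neg (by linarith), Real.rpow_neg (by linarith), ← Real.sqrt_eq_rpow,
    ← Real.sqrt_eq_rpow, ← div_eq_inv_mul, inv_eq_one_div,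
    div_le_div_iff₀ (Real.sqrt_pos.mpr (by linarith)) (Real.sqrt_pos.mpr (by linarith)), one_mul,
    ← Real.sqrt_mul hd'.le]
  exact Real.sqrt_le_sqrt hbern

/-- **Theorem 2, Eq. (9) (upper bound on robustness to random uniform noise).**
For a linear classifier `f(x) = wᵀx + b` with `w ≠ 0` and `ε ∈ (0, 1/12)`,
`ρ_unif,ε(f) ≤ C̃₂(ε,d) ρ_adv(f) ≤ C₂(ε) √d ρ_adv(f)` with
`C̃₂(ε,d) = (1 − (12ε)^{1/d})^{-1/2}` and `C₂(ε) = (1 − 12ε)^{-1/2}`. -/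
theorem linear_unif_robustness_upper_bound {d : ℕ} (hd : 0 < d)
    (w : EuclideanSpace ℝ (Fin d)) (hw : w ≠ 0) (b : ℝ)
    (μ : Measure (EuclideanSpace ℝ (Fin d))) [IsProbabilityMeasure μ]
    (ε : ℝ) (hε0 : 0 < ε) (hε : ε < 1 / 12)
    (hadv : Integrable (fun x => deltaAdv (fun y => ⟪w, y⟫ + b) x) μ)
    (hunif : Integrable (fun x => deltaUnif (fun y => ⟪w, y⟫ + b) ε x) μ) :
    ∫ x, deltaUnif (fun y => ⟪w, y⟫ + b) ε x ∂μ ≤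
      (1 - (12 * ε) ^ ((d : ℝ)⁻¹)) ^ (-(1 / 2) : ℝ) *
        ∫ x, deltaAdv (fun y => ⟪w, y⟫ + b) x ∂μ ∧
    (1 - (12 * ε) ^ ((d : ℝ)⁻¹)) ^ (-(1 / 2) : ℝ) *
        (∫ x, deltaAdv (fun y => ⟪w, y⟫ + b) x ∂μ) ≤
      (1 - 12 * ε) ^ (-(1 / 2) : ℝ) * Real.sqrt d *
        ∫ x, deltaAdv (fun y => ⟪w, y⟫ + b) x ∂μ := by
  constructor
  · rw [← integral_const_mul]
    exact integral_mono hunif (hadv.const_mul _)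
      fun x => deltaUnif_le_mul_deltaAdv hd hw b hε0 hε x
  · exact mul_le_mul_of_nonneg_right
      (rpow_neg_half_le_mul_sqrt hd (by positivity) (by linarith))
      (integral_nonneg fun x => deltaAdv_nonneg _ x)
end

section
/- Let A be a symmetric d×d real matrix with λ_min(A) < 0 and λ_max(A) > 0, and let f(x) = xᵀAx. Then for every x ∈ ℝ^d with f(x) ≥ 0, dist(x, {y : f(y) ≤ 0}) ≤ |λ_min(A)|^{−1/2} · f(x)^{1/2}, and for every x with f(x) ≤ 0, dist(x, {y : f(y) ≥ 0}) ≤ |λ_max(A)|^{−1/2} · (−f(x))^{1/2}. In particular, Assumption (A) holds for f with τ = max(|λ_min(A)|^{−1/2}, |λ_max(A)|^{−1/2}) and γ = 1/2. -/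
open MeasureTheory Metric

/-- The quadratic form `x ↦ xᵀ A x` on `ℝ^d`. -/
def quadForm {d : ℕ} (A : Matrix (Fin d) (Fin d) ℝ) (x : EuclideanSpace ℝ (Fin d)) : ℝ :=
  ∑ i, ∑ j, x i * A i j * x j

theorem quadForm_eq_dotProduct {d : ℕ} (A : Matrix (Fin d) (Fin d) ℝ)
    (x : EuclideanSpace ℝ (Fin d)) :
    quadForm A x = x.ofLp ⬝ᵥ A.mulVec x.ofLp := by
  simp only [quadForm, dotProduct, Matrix.mulVec, Finset.mul_sum, mul_assoc]

/-- Expansion of the quadratic form of `A` along an eigenvector of `A` of norm one. -/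
theorem quadForm_add_smul_eigenvectorBasis {d : ℕ} {A : Matrix (Fin d) (Fin d) ℝ}
    (hA : A.IsHermitian) (i : Fin d) (x : EuclideanSpace ℝ (Fin d)) (t : ℝ) :
    quadForm A (x + t • hA.eigenvectorBasis i) = quadForm A x +
      hA.eigenvalues i * (2 * t * inner ℝ x (hA.eigenvectorBasis i) + t ^ 2) := by
  have hv := hA.mulVec_eigenvectorBasis i
  have hn : (hA.eigenvectorBasis i).ofLp ⬝ᵥ (hA.eigenvectorBasis i).ofLp = 1 := by
    have h := real_inner_self_eq_norm_sq (hA.eigenvectorBasis i)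
    rw [hA.eigenvectorBasis.norm_eq_one i, EuclideanSpace.inner_eq_star_dotProduct] at h
    simpa using h
  have hi : inner ℝ x (hA.eigenvectorBasis i) = x.ofLp ⬝ᵥ (hA.eigenvectorBasis i).ofLp := by
    rw [EuclideanSpace.inner_eq_star_dotProduct, dotProduct_comm]
    simp
  have hs : (hA.eigenvectorBasis i).ofLp ⬝ᵥ A.mulVec x.ofLp =
      hA.eigenvalues i * (x.ofLp ⬝ᵥ (hA.eigenvectorBasis i).ofLp) := by
    have hT : A.transpose = A := by simpa [Matrix.IsHermitian] using hA
    rw [Matrix.dotProduct_mulVec, ← Matrix.mulVec_transpose, hT, hv, smul_dotProduct,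
      dotProduct_comm, smul_eq_mul]
  rw [hi]
  simp only [quadForm_eq_dotProduct, WithLp.ofLp_add, WithLp.ofLp_smul, Matrix.mulVec_add,
    Matrix.mulVec_smul, add_dotProduct, dotProduct_add, smul_dotProduct, dotProduct_smul,
    smul_eq_mul, hv, hs, hn]
  ring

/-- If `g` is quadratic with negative leading coefficient along a unit vector `v`, then walking
from `x` along `v` or `-v` reaches `{g ≤ 0}` within the expected distance. -/
theorem infDist_setOf_nonpos_le {E : Type*} [NormedAddCommGroup E] [NormedSpace ℝ E]
    {g : E → ℝ} {x v : E} {l b : ℝ} (hv : ‖v‖ = 1) (hl : l < 0)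
    (hg : ∀ t : ℝ, g (x + t • v) = g x + l * (2 * t * b + t ^ 2)) (hx : 0 ≤ g x) :
    Metric.infDist x {y | g y ≤ 0} ≤ |l| ^ (-(1 / 2) : ℝ) * g x ^ ((1 : ℝ) / 2) := by
  set r := |l| ^ (-(1 / 2) : ℝ) * g x ^ ((1 : ℝ) / 2) with hr
  have hl' : 0 < |l| := abs_pos.2 hl.ne
  have hr0 : 0 ≤ r := by positivity
  have hrsq : l * r ^ 2 = -g x := by
    rw [hr, mul_pow, ← Real.rpow_mul_natCast hl'.le, ← Real.rpow_mul_natCast hx]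
    norm_num [Real.rpow_neg_one]
    rw [abs_of_neg hl]
    have := hl.ne
    field_simp
  obtain ⟨t, ht, htb⟩ : ∃ t : ℝ, |t| = r ∧ 0 ≤ t * b := by
    rcases le_total 0 b with hb | hb
    · exact ⟨r, abs_of_nonneg hr0, mul_nonneg hr0 hb⟩
    · exact ⟨-r, by rw [abs_neg, abs_of_nonneg hr0], by nlinarith⟩
  have hmem : x + t • v ∈ {y | g y ≤ 0} := by
    have hsq : t ^ 2 = r ^ 2 := by rw [← ht, sq_abs]
    rw [Set.mem_ofPred_eq, hg, hsq]
    nlinarith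
  refine (Metric.infDist_le_dist_of_mem hmem).trans_eq ?_
  rw [dist_self_add_right, norm_smul, hv, mul_one, Real.norm_eq_abs, ht]

/-- **Lemma 3 (quadratic classifiers satisfy Assumption (A)).**
For `f(x) = xᵀAx` with `A` symmetric, `λ_min(A) < 0 < λ_max(A)`:
if `f(x) ≥ 0` then `dist(x, {f ≤ 0}) ≤ |λ_min|^{-1/2} f(x)^{1/2}`, symmetrically for
`f(x) ≤ 0`; in particular Assumption (A) holds with
`τ = max(|λ_min|^{-1/2}, |λ_max|^{-1/2})` and `γ = 1/2`. -/
theorem quadratic_assumption_A {d : ℕ} (A : Matrix (Fin d) (Fin d) ℝ)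
    (hA : A.IsHermitian) (lmin lmax : ℝ)
    (hlmin : IsLeast (Set.range hA.eigenvalues) lmin)
    (hlmax : IsGreatest (Set.range hA.eigenvalues) lmax)
    (hmin : lmin < 0) (hmax : 0 < lmax) :
    (∀ x : EuclideanSpace ℝ (Fin d), 0 ≤ quadForm A x →
      Metric.infDist x {y : EuclideanSpace ℝ (Fin d) | quadForm A y ≤ 0} ≤
        |lmin| ^ (-(1 / 2) : ℝ) * (quadForm A x) ^ ((1 : ℝ) / 2)) ∧
    (∀ x : EuclideanSpace ℝ (Fin d), quadForm A x ≤ 0 →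
      Metric.infDist x {y : EuclideanSpace ℝ (Fin d) | 0 ≤ quadForm A y} ≤
        |lmax| ^ (-(1 / 2) : ℝ) * (-(quadForm A x)) ^ ((1 : ℝ) / 2)) ∧
    (∀ x : EuclideanSpace ℝ (Fin d),
      Metric.infDist x {y : EuclideanSpace ℝ (Fin d) | quadForm A y ≤ 0} ≤
        max (|lmin| ^ (-(1 / 2) : ℝ)) (|lmax| ^ (-(1 / 2) : ℝ)) *
          (max 0 (quadForm A x)) ^ ((1 : ℝ) / 2) ∧
      Metric.infDist x {y : EuclideanSpace ℝ (Fin d) | 0 ≤ quadForm A y} ≤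
        max (|lmin| ^ (-(1 / 2) : ℝ)) (|lmax| ^ (-(1 / 2) : ℝ)) *
          (max 0 (-(quadForm A x))) ^ ((1 : ℝ) / 2)) := by
  obtain ⟨⟨i, hi⟩, -⟩ := hlmin
  obtain ⟨⟨j, hj⟩, -⟩ := hlmax
  have hneg : ∀ x : EuclideanSpace ℝ (Fin d), 0 ≤ quadForm A x →
      Metric.infDist x {y : EuclideanSpace ℝ (Fin d) | quadForm A y ≤ 0} ≤
        |lmin| ^ (-(1 / 2) : ℝ) * (quadForm A x) ^ ((1 : ℝ) / 2) := fun x hx =>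
    infDist_setOf_nonpos_le (hA.eigenvectorBasis.norm_eq_one i) hmin
      (fun t => hi ▸ quadForm_add_smul_eigenvectorBasis hA i x t) hx
  have hpos : ∀ x : EuclideanSpace ℝ (Fin d), quadForm A x ≤ 0 →
      Metric.infDist x {y : EuclideanSpace ℝ (Fin d) | 0 ≤ quadForm A y} ≤
        |lmax| ^ (-(1 / 2) : ℝ) * (-(quadForm A x)) ^ ((1 : ℝ) / 2) := fun x hx => by
    have h := infDist_setOf_nonpos_le (g := fun y => -quadForm A y) (x := x)
      (b := inner ℝ x (hA.eigenvectorBasis j))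
      (hA.eigenvectorBasis.norm_eq_one j) (neg_neg_of_pos hmax)
      (fun t => by rw [quadForm_add_smul_eigenvectorBasis hA j x t, hj]; ring)
      (neg_nonneg.2 hx)
    simpa only [abs_neg, neg_nonpos] using h
  refine ⟨hneg, hpos, fun x => ⟨?_, ?_⟩⟩
  · rcases le_total 0 (quadForm A x) with hx | hx
    · rw [max_eq_right hx]
      exact (hneg x hx).trans (by gcongr; exact le_max_left _ _)
    · rw [Metric.infDist_zero_of_mem (show x ∈ {y | quadForm A y ≤ 0} from hx)]
      positivity
  · rcases le_total (quadForm A x) 0 with hx | hx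
    · rw [max_eq_right (neg_nonneg.2 hx)]
      exact (hpos x hx).trans (by
        have := neg_nonneg.2 hx
        gcongr
        exact le_max_right _ _)
    · rw [Metric.infDist_zero_of_mem (show x ∈ {y | 0 ≤ quadForm A y} from hx)]
      positivity
end

section
/- Let w ∈ ℝ^d be a vector of unit ℓ₂ norm, let τ ∈ [0, 1), and let x be sampled from the uniform (rotation-invariant) probability measure on the unit sphere 𝕊^{d−1} ⊂ ℝ^d. Then (1/12)(1 − τ²)^d ≤ P(wᵀx ≥ τ) ≤ 2 exp(−τ² d / 2). -/
open MeasureTheory Metric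
open scoped RealInnerProductSpace ENNReal

open scoped Pointwise

/-- The part of the punctured open unit ball in the cone `τ * ‖x‖ ≤ ⟪w, x⟫`. -/
def ballSector {d : ℕ} (w : EuclideanSpace ℝ (Fin d)) (τ : ℝ) :
    Set (EuclideanSpace ℝ (Fin d)) :=
  {x | 0 < ‖x‖ ∧ ‖x‖ < 1 ∧ τ * ‖x‖ ≤ ⟪w, x⟫}

/-- A cap has uniform measure equal to the fraction of the unit ball occupied by its sector. -/
lemma unifSphere_cap_eq {d : ℕ} (hd : 0 < d) (w : EuclideanSpace ℝ (Fin d)) (τ : ℝ) :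
    unifSphere d 1 {x : EuclideanSpace ℝ (Fin d) | τ ≤ ⟪w, x⟫} =
      volume (ballSector w τ) / volume (ball (0 : EuclideanSpace ℝ (Fin d)) 1) := by
  have hm : MeasurableSet {x : EuclideanSpace ℝ (Fin d) | τ ≤ ⟪w, x⟫} :=
    measurableSet_le measurable_const (by fun_prop)
  have hsec : Set.Ioo (0 : ℝ) 1 • ((↑) '' {z : sphere (0 : EuclideanSpace ℝ (Fin d)) 1 |
      τ ≤ ⟪w, (z : EuclideanSpace ℝ (Fin d))⟫} : Set (EuclideanSpace ℝ (Fin d))) =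
      ballSector w τ := by
    ext x
    simp only [Set.mem_smul, Set.mem_image, ballSector, Set.mem_ofPred_eq]
    constructor
    · rintro ⟨r, ⟨hr0, hr1⟩, _, ⟨z, hz, rfl⟩, rfl⟩
      have hn : ‖(z : EuclideanSpace ℝ (Fin d))‖ = 1 := by simp
      rw [norm_smul, hn, Real.norm_of_nonneg hr0.le, inner_smul_right]
      refine ⟨by linarith, by linarith, by nlinarith⟩
    · rintro ⟨h0, h1, h⟩
      refine ⟨‖x‖, ⟨h0, h1⟩, ‖x‖⁻¹ • x, ⟨⟨‖x‖⁻¹ • x, ?_⟩, ?_, rfl⟩, ?_⟩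
      · simp [norm_smul, h0.ne']
      · change τ ≤ ⟪w, ‖x‖⁻¹ • x⟫
        rw [inner_smul_right, inv_mul_eq_div, le_div_iff₀ h0]
        exact h
      · rw [smul_smul, mul_inv_cancel₀ h0.ne', one_smul]
  have hd' : (d : ℝ≥0∞) ≠ 0 := by exact_mod_cast hd.ne'
  have hf : Measurable (fun z : sphere (0 : EuclideanSpace ℝ (Fin d)) 1 =>
      (1 : ℝ) • (z : EuclideanSpace ℝ (Fin d))) := by fun_prop
  rw [unifSphere, Measure.smul_apply, Measure.map_apply hf hm]
  simp only [Set.preimage_ofPred_eq, one_smul]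
  rw [Measure.toSphere_apply' _ (measurableSet_le measurable_const (by fun_prop)), hsec,
    Measure.toSphere_apply_univ, finrank_euclideanSpace_fin, smul_eq_mul, mul_comm,
    ← div_eq_mul_inv, ENNReal.mul_div_mul_left _ _ hd' (by simp)]

lemma volume_ball_le_two_mul_volume_half {d : ℕ} (w : EuclideanSpace ℝ (Fin d)) :
    volume (ball (0 : EuclideanSpace ℝ (Fin d)) 1) ≤
      2 * volume {x : EuclideanSpace ℝ (Fin d) | ‖x‖ < 1 ∧ 0 ≤ ⟪w, x⟫} := by
  set H := {x : EuclideanSpace ℝ (Fin d) | ‖x‖ < 1 ∧ 0 ≤ ⟪w, x⟫}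
  calc volume (ball (0 : EuclideanSpace ℝ (Fin d)) 1) ≤ volume (H ∪ -H) := by
        refine measure_mono fun x hx => ?_
        rw [mem_ball_zero_iff] at hx
        rcases le_total 0 ⟪w, x⟫ with h | h
        · exact Or.inl ⟨hx, h⟩
        · refine Or.inr ⟨by rwa [norm_neg], ?_⟩
          rw [inner_neg_right]
          linarith
    _ ≤ volume H + volume (-H) := measure_union_le _ _
    _ = 2 * volume H := by rw [Measure.measure_neg, two_mul]

lemma sq_add_half_ellipsoid_le_one {τ u : ℝ} (hτ0 : 0 ≤ τ) (hτ1 : τ < 1) (hu1 : u ≤ 1) :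
    (τ + (1 - τ ^ 2) * u / 6) ^ 2 + (1 - τ ^ 2) ^ 2 * (1 - u ^ 2) ≤ 1 := by
  have hq : 0 ≤ 1 - τ ^ 2 := by nlinarith
  have key : τ * u / 3 - 35 / 36 * (1 - τ ^ 2) * u ^ 2 ≤ τ ^ 2 := by
    rcases le_total (1 / 3) τ with h | h
    · nlinarith [mul_nonneg hq (sq_nonneg u), mul_nonneg hτ0 (sub_nonneg.2 hu1),
        mul_nonneg hτ0 (sub_nonneg.2 h)]
    · have : 8 / 9 ≤ 1 - τ ^ 2 := by nlinarith
      nlinarith [sq_nonneg (τ - u / 6), mul_nonneg (sub_nonneg.2 this) (sq_nonneg u), sq_nonneg u]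
  nlinarith [mul_nonneg hq (sub_nonneg.2 key)]

/-- The sector contains an affine image of half the unit ball, contracted by `1 - τ ^ 2` and by a
further factor `6` in direction `w`. -/
lemma le_volume_ballSector {d : ℕ} {w : EuclideanSpace ℝ (Fin d)} (hw : ‖w‖ = 1)
    {τ : ℝ} (hτ0 : 0 ≤ τ) (hτ1 : τ < 1) :
    ENNReal.ofReal ((1 / 12) * (1 - τ ^ 2) ^ d) *
      volume (ball (0 : EuclideanSpace ℝ (Fin d)) 1) ≤ volume (ballSector w τ) := by
  have : Nontrivial (EuclideanSpace ℝ (Fin d)) := ⟨w, 0, by rintro rfl; simp at hw⟩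
  have hq : 0 < 1 - τ ^ 2 := by nlinarith
  set q := 1 - τ ^ 2 with hqdef
  set H := {x : EuclideanSpace ℝ (Fin d) | ‖x‖ < 1 ∧ 0 ≤ ⟪w, x⟫}
  let A : EuclideanSpace ℝ (Fin d) →ₗ[ℝ] EuclideanSpace ℝ (Fin d) :=
    q • LinearMap.transvection (innerₛₗ ℝ w) (-(5 / 6 : ℝ) • w)
  have hdet : LinearMap.det A = q ^ d * (1 / 6) := by
    rw [LinearMap.det_smul, LinearMap.transvection.det, finrank_euclideanSpace_fin]
    simp only [innerₛₗ_apply_apply, inner_smul_right, real_inner_self_eq_norm_sq, hw]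
    norm_num
  have hsub : (fun x => τ • w + x) '' (A '' H) \ {0} ⊆ ballSector w τ := by
    rintro _ ⟨⟨_, ⟨x, ⟨hx, hu⟩, rfl⟩, rfl⟩, hne⟩
    have hA : τ • w + A x = (τ - 5 / 6 * q * ⟪w, x⟫) • w + q • x := by
      simp only [A, LinearMap.smul_apply, LinearMap.transvection.apply, innerₛₗ_apply_apply]
      module
    have hu1 : ⟪w, x⟫ ≤ 1 := by
      have := real_inner_le_norm w x
      rw [hw] at this
      linarith
    have hin : ⟪w, τ • w + A x⟫ = τ + q * ⟪w, x⟫ / 6 := by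
      rw [hA, inner_add_right, inner_smul_right, inner_smul_right, real_inner_self_eq_norm_sq, hw]
      ring
    have hnorm : ‖τ • w + A x‖ < 1 := by
      have hsq : ‖τ • w + A x‖ ^ 2 =
          (τ + q * ⟪w, x⟫ / 6) ^ 2 + q ^ 2 * (‖x‖ ^ 2 - ⟪w, x⟫ ^ 2) := by
        rw [hA, norm_add_sq_real, norm_smul, norm_smul, mul_pow, mul_pow, hw, inner_smul_left,
          inner_smul_right, Real.norm_eq_abs, Real.norm_eq_abs, sq_abs, sq_abs]
        simp only [conj_trivial]
        ring
      have h1 := sq_add_half_ellipsoid_le_one hτ0 hτ1 hu1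
      rw [← hqdef] at h1
      have hx2 : ‖x‖ ^ 2 < 1 := by nlinarith [norm_nonneg x]
      have := mul_lt_mul_of_pos_left hx2 (pow_pos hq 2)
      refine lt_of_pow_lt_pow_left₀ 2 zero_le_one ?_
      rw [hsq]
      linarith
    refine ⟨norm_pos_iff.2 hne, hnorm, ?_⟩
    change τ * ‖τ • w + A x‖ ≤ ⟪w, τ • w + A x⟫
    rw [hin]
    nlinarith [mul_nonneg hτ0 (sub_nonneg.2 hnorm.le), mul_nonneg hq.le hu]
  calc ENNReal.ofReal ((1 / 12) * q ^ d) * volume (ball (0 : EuclideanSpace ℝ (Fin d)) 1)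
      ≤ ENNReal.ofReal ((1 / 12) * q ^ d) * (2 * volume H) := by
        gcongr
        exact volume_ball_le_two_mul_volume_half w
    _ = ENNReal.ofReal |LinearMap.det A| * volume H := by
        rw [hdet, abs_of_nonneg (by positivity), ← mul_assoc,
          show q ^ d * (1 / 6) = 1 / 12 * q ^ d * 2 by ring,
          ENNReal.ofReal_mul (by positivity) (q := 2), ENNReal.ofReal_ofNat]
    _ = volume ((fun x => τ • w + x) '' (A '' H) \ {0}) := by
        rw [measure_sdiff_null (measure_singleton _), Set.image_add_left, measure_preimage_add,
          Measure.addHaar_image_linearMap]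
    _ ≤ volume (ballSector w τ) := measure_mono hsub

lemma volume_le_of_subset_closedBall {d : ℕ} {s : Set (EuclideanSpace ℝ (Fin d))}
    {c : EuclideanSpace ℝ (Fin d)} {r a : ℝ} (hr : 0 ≤ r) (hs : s ⊆ closedBall c r)
    (hra : r ≤ Real.exp (-a)) :
    volume s ≤ ENNReal.ofReal (Real.exp (-(a * d))) *
      volume (ball (0 : EuclideanSpace ℝ (Fin d)) 1) := by
  calc volume s ≤ volume (closedBall c r) := measure_mono hs
    _ = ENNReal.ofReal (r ^ d) * volume (ball (0 : EuclideanSpace ℝ (Fin d)) 1) := by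
        rw [Measure.addHaar_closedBall _ _ hr, finrank_euclideanSpace_fin]
    _ ≤ _ := by
        gcongr
        calc r ^ d ≤ Real.exp (-a) ^ d := by gcongr
          _ = Real.exp (-(a * d)) := by rw [← Real.exp_nat_mul]; congr 1; ring

lemma volume_ballSector_le {d : ℕ} {w : EuclideanSpace ℝ (Fin d)} (hw : ‖w‖ = 1)
    {τ : ℝ} (hτ0 : 0 ≤ τ) (hτ1 : τ < 1) :
    volume (ballSector w τ) ≤ ENNReal.ofReal (Real.exp (-(τ ^ 2 / 2 * d))) *
      volume (ball (0 : EuclideanSpace ℝ (Fin d)) 1) := by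
  have hdist (x : EuclideanSpace ℝ (Fin d)) (a : ℝ) :
      ‖x - a • w‖ ^ 2 = ‖x‖ ^ 2 - 2 * a * ⟪w, x⟫ + a ^ 2 := by
    rw [norm_sub_sq_real, norm_smul, hw, inner_smul_right, real_inner_comm, mul_one,
      Real.norm_eq_abs, sq_abs]
    ring
  have hexp : Real.exp (-(τ ^ 2 / 2)) ^ 2 = Real.exp (-τ ^ 2) := by
    rw [← Real.exp_nat_mul]
    congr 1
    push_cast
    ring
  rcases le_total (τ ^ 2) (1 / 2) with h | h
  · have hq : 0 ≤ 1 - τ ^ 2 := by linarith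
    refine volume_le_of_subset_closedBall (c := τ • w) (Real.sqrt_nonneg (1 - τ ^ 2)) ?_ ?_
    · rintro x ⟨h0, h1, hx⟩
      rw [mem_closedBall_iff_norm]
      refine Real.le_sqrt_of_sq_le ?_
      rw [hdist]
      nlinarith [mul_nonneg hτ0 (sub_nonneg.2 hx),
        mul_nonneg (sub_nonneg.2 h1.le) (by linarith : 0 ≤ ‖x‖ + 1 - 2 * τ ^ 2)]
    · rw [Real.sqrt_le_left (Real.exp_pos _).le, hexp]
      linarith [Real.add_one_le_exp (-τ ^ 2)]
  · have hτ : 0 < τ := by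
      rcases hτ0.eq_or_lt with rfl | h'
      · norm_num at h
      · exact h'
    refine volume_le_of_subset_closedBall (c := (1 / (2 * τ)) • w) (r := 1 / (2 * τ))
      (by positivity) ?_ ?_
    · rintro x ⟨h0, h1, hx⟩
      rw [mem_closedBall_iff_norm]
      refine (sq_le_sq₀ (by positivity) (by positivity)).1 ?_
      rw [hdist]
      have : ‖x‖ ^ 2 ≤ 2 * (1 / (2 * τ)) * ⟪w, x⟫ := by
        rw [show 2 * (1 / (2 * τ)) * ⟪w, x⟫ = ⟪w, x⟫ / τ by field_simp, le_div_iff₀ hτ]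
        nlinarith [mul_nonneg hτ0 (mul_nonneg h0.le (sub_nonneg.2 h1.le))]
      linarith
    · refine (sq_le_sq₀ (by positivity) (by positivity)).1 ?_
      rw [hexp, Real.exp_neg, div_pow, one_pow, one_div]
      refine inv_anti₀ (Real.exp_pos _) ?_
      have h2 := Real.add_one_le_exp (1 - τ ^ 2)
      have h3 : Real.exp (τ ^ 2) * Real.exp (1 - τ ^ 2) = Real.exp 1 := by
        rw [← Real.exp_add]
        congr 1
        ring
      have h4 := Real.exp_one_lt_d9
      have h5 := Real.exp_pos (τ ^ 2)
      have h6 : Real.exp (τ ^ 2) * (2 - τ ^ 2) ≤ (2 * τ) ^ 2 * (2 - τ ^ 2) := by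
        nlinarith [mul_le_mul_of_nonneg_left h2 h5.le,
          mul_nonneg (sub_nonneg.2 h) (by nlinarith : 0 ≤ 3 / 2 - τ ^ 2)]
      exact le_of_mul_le_mul_right h6 (by nlinarith)

/-- **Lemma 6 (concentration of measure on the sphere).** For a unit vector `w` in `ℝ^d`,
`τ ∈ [0, 1)`, and `x` uniform on the unit sphere,
`(1/12)(1 − τ²)^d ≤ P(wᵀx ≥ τ) ≤ 2 exp(−τ² d / 2)`. -/
theorem sphere_cap_measure_bounds {d : ℕ} (hd : 0 < d)
    (w : EuclideanSpace ℝ (Fin d)) (hw : ‖w‖ = 1) (τ : ℝ) (hτ0 : 0 ≤ τ) (hτ1 : τ < 1) :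
    ENNReal.ofReal ((1 / 12) * (1 - τ ^ 2) ^ d) ≤
      unifSphere d 1 {x : EuclideanSpace ℝ (Fin d) | τ ≤ ⟪w, x⟫} ∧
    unifSphere d 1 {x : EuclideanSpace ℝ (Fin d) | τ ≤ ⟪w, x⟫} ≤
      ENNReal.ofReal (2 * Real.exp (-(τ ^ 2 * d) / 2)) := by
  have hB0 : volume (ball (0 : EuclideanSpace ℝ (Fin d)) 1) ≠ 0 :=
    (measure_ball_pos _ _ one_pos).ne'
  have hBt : volume (ball (0 : EuclideanSpace ℝ (Fin d)) 1) ≠ ⊤ := measure_ball_lt_top.ne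
  rw [unifSphere_cap_eq hd, ENNReal.le_div_iff_mul_le (Or.inl hB0) (Or.inl hBt),
    ENNReal.div_le_iff hB0 hBt]
  refine ⟨le_volume_ballSector hw hτ0 hτ1, (volume_ballSector_le hw hτ0 hτ1).trans ?_⟩
  gcongr
  rw [show -(τ ^ 2 * d) / 2 = -(τ ^ 2 / 2 * d) by ring]
  linarith [Real.exp_pos (-(τ ^ 2 / 2 * d))]
end

section
/- Let f(x) = wᵀx + b be a linear classifier on ℝ^d with w ≠ 0, let x ∈ ℝ^d, and let ε ∈ (0, 1/12). Then Δ_unif,ε(x;f) ≥ C₁(ε) √d · Δ_adv(x;f), where C₁(ε) = (2 ln(2/ε))^{−1/2}. -/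
open MeasureTheory Metric
open scoped RealInnerProductSpace ENNReal

/-- The part of the open unit ball lying on the rays through the spherical cap
`{z | a ≤ η ⟪u, z⟫}`, with the origin removed. -/
def capCone {E : Type*} [NormedAddCommGroup E] [InnerProductSpace ℝ E] (u : E) (a η : ℝ) :
    Set E :=
  {x | x ∈ ball (0 : E) 1 ∧ x ≠ 0 ∧ a * ‖x‖ ≤ η * ⟪u, x⟫}

open scoped Pointwise in
theorem Ioo_smul_cap_eq_capCone {E : Type*} [NormedAddCommGroup E] [InnerProductSpace ℝ E]
    (u : E) (a η : ℝ) :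
    Set.Ioo (0 : ℝ) 1 •
        ((↑) '' {z : sphere (0 : E) 1 | a ≤ ⟪u, η • (z : E)⟫} : Set E) = capCone u a η := by
  ext x
  simp only [Set.mem_smul, Set.mem_image, Set.mem_ofPred_eq, capCone, mem_ball_zero_iff]
  constructor
  · rintro ⟨r, ⟨hr0, hr1⟩, _, ⟨z, hz, rfl⟩, rfl⟩
    have hz1 : ‖(z : E)‖ = 1 := by simp
    have hn : ‖r • (z : E)‖ = r := by rw [norm_smul, hz1, Real.norm_of_nonneg hr0.le, mul_one]
    refine ⟨by rwa [hn], norm_pos_iff.1 (by rwa [hn]), ?_⟩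
    rw [hn, inner_smul_right]
    rw [inner_smul_right] at hz
    nlinarith
  · rintro ⟨hx1, hx0, hx⟩
    have hn : 0 < ‖x‖ := norm_pos_iff.2 hx0
    refine ⟨‖x‖, ⟨hn, hx1⟩, ‖x‖⁻¹ • x, ⟨⟨‖x‖⁻¹ • x, ?_⟩, ?_, rfl⟩, ?_⟩
    · simp [norm_smul, hn.ne']
    · simp only [inner_smul_right]
      rw [mul_left_comm, ← div_eq_inv_mul, le_div_iff₀ hn]
      exact hx
    · rw [smul_smul, mul_inv_cancel₀ hn.ne', one_smul]

theorem unifSphere_halfSpace {d : ℕ} (hd : 0 < d) (u : EuclideanSpace ℝ (Fin d)) (a η : ℝ) :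
    unifSphere d η {n | a ≤ ⟪u, n⟫} =
      (volume (ball (0 : EuclideanSpace ℝ (Fin d)) 1))⁻¹ * volume (capCone u a η) := by
  have : Nonempty (Fin d) := ⟨⟨0, hd⟩⟩
  have hm : MeasurableSet {n : EuclideanSpace ℝ (Fin d) | a ≤ ⟪u, n⟫} :=
    (isClosed_le continuous_const (by fun_prop)).measurableSet
  have hf : Measurable (fun z : sphere (0 : EuclideanSpace ℝ (Fin d)) 1 =>
      η • (z : EuclideanSpace ℝ (Fin d))) := by fun_prop
  rw [unifSphere, Measure.smul_apply, Measure.map_apply hf hm,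
    Measure.toSphere_apply' _ (hf hm), Measure.toSphere_apply_univ, smul_eq_mul,
    ← Ioo_smul_cap_eq_capCone, finrank_euclideanSpace_fin]
  have h0 : (d : ℝ≥0∞) ≠ 0 := by exact_mod_cast hd.ne'
  rw [ENNReal.mul_inv (Or.inl h0) (Or.inl (by simp)), mul_mul_mul_comm,
    ENNReal.inv_mul_cancel h0 (by simp), one_mul]
  rfl

theorem exists_enclosing_radius {t : ℝ} (ht0 : 0 ≤ t) (ht1 : t ≤ 1) :
    ∃ c R : ℝ, 0 ≤ c ∧ 0 ≤ R ∧ R ≤ Real.exp (-t ^ 2 / 2) ∧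
      ∀ r, 0 ≤ r → r ≤ 1 → r ^ 2 - 2 * c * t * r + c ^ 2 ≤ R ^ 2 := by
  rcases le_total (t ^ 2) (1 / 2) with h | h
  · refine ⟨t, √(1 - t ^ 2), ht0, Real.sqrt_nonneg _, ?_, fun r hr0 hr1 => ?_⟩
    · rw [Real.sqrt_le_left (Real.exp_pos _).le, ← Real.exp_nat_mul]
      have := Real.add_one_le_exp (-t ^ 2)
      rw [show ((2 : ℕ) : ℝ) * (-t ^ 2 / 2) = -t ^ 2 by push_cast; ring]
      linarith
    · rw [Real.sq_sqrt (by linarith)]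
      nlinarith
  · have ht : 0 < t := by
      rcases ht0.eq_or_lt with rfl | h'
      · norm_num at h
      · exact h'
    refine ⟨1 / (2 * t), 1 / (2 * t), by positivity, by positivity, ?_, fun r hr0 hr1 => ?_⟩
    · refine abs_le_of_sq_le_sq' ?_ (Real.exp_pos _).le |>.2
      rw [← Real.exp_nat_mul, show ((2 : ℕ) : ℝ) * (-t ^ 2 / 2) = (1 - t ^ 2) - 1 by
        push_cast; ring, Real.exp_sub, div_pow, div_le_div_iff₀ (by positivity) (Real.exp_pos _)]
      have h1 := Real.add_one_le_exp (1 - t ^ 2)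
      have h2 := Real.exp_one_lt_d9
      have h3 : t ^ 2 ≤ 1 := by nlinarith
      nlinarith
    · rw [show 2 * (1 / (2 * t)) * t * r = r by field_simp]
      nlinarith

/-- The spherical cap estimate: the cone over a cap of height `t` occupies at most the
proportion `exp (-d t² / 2)` of the unit ball. -/
theorem volume_capCone_le {d : ℕ} {u : EuclideanSpace ℝ (Fin d)} (hu : ‖u‖ = 1) {a η : ℝ}
    (ha : 0 ≤ a) (hη : 0 < η) :
    volume (capCone u a η) ≤ ENNReal.ofReal (Real.exp (-(d * (a / η) ^ 2) / 2)) *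
      volume (ball (0 : EuclideanSpace ℝ (Fin d)) 1) := by
  have ht0 : 0 ≤ a / η := by positivity
  have hin : ∀ x ∈ capCone u a η, a / η * ‖x‖ ≤ ⟪u, x⟫ := fun x hx => by
    rw [div_mul_eq_mul_div, div_le_iff₀ hη, mul_comm ⟪u, x⟫]
    exact hx.2.2
  rcases lt_or_ge 1 (a / η) with h | h
  · have : capCone u a η = ∅ := Set.eq_empty_of_forall_notMem fun x hx => by
      have h1 := hin x hx
      have h2 := real_inner_le_norm u x
      have h3 : 0 < ‖x‖ := norm_pos_iff.2 hx.2.1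
      rw [hu] at h2
      nlinarith
    simp [this]
  · obtain ⟨c, R, hc, hR, hRe, hr⟩ := exists_enclosing_radius ht0 h
    have hsub : capCone u a η ⊆ closedBall (c • u) R := fun x hx => by
      rw [mem_closedBall_iff_norm]
      refine abs_le_of_sq_le_sq' ?_ hR |>.2
      have h1 := hin x hx
      have h2 := hr ‖x‖ (norm_nonneg x) (mem_ball_zero_iff.1 hx.1).le
      rw [norm_sub_sq_real, inner_smul_right, norm_smul, hu, real_inner_comm, mul_one,
        Real.norm_of_nonneg hc]
      nlinarith [mul_le_mul_of_nonneg_left h1 hc]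
    refine (measure_mono hsub).trans ?_
    rw [Measure.addHaar_closedBall _ _ hR, finrank_euclideanSpace_fin]
    gcongr
    calc R ^ d ≤ Real.exp (-(a / η) ^ 2 / 2) ^ d := by gcongr
      _ = _ := by rw [← Real.exp_nat_mul]; ring_nf

theorem volume_ball_le_two_mul_halfBall {E : Type*} [NormedAddCommGroup E]
    [InnerProductSpace ℝ E] [FiniteDimensional ℝ E] [MeasurableSpace E] [BorelSpace E]
    {u : E} (hu : u ≠ 0) :
    volume (ball (0 : E) 1) ≤ 2 * volume {x : E | x ∈ ball (0 : E) 1 ∧ 0 < ⟪u, x⟫} := by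
  set H := {x : E | x ∈ ball (0 : E) 1 ∧ 0 < ⟪u, x⟫}
  have hplane : volume ((ℝ ∙ u)ᗮ : Set E) = 0 := by
    refine Measure.addHaar_submodule _ _ fun h => hu ?_
    have : u ∈ (ℝ ∙ u)ᗮ := h ▸ Submodule.mem_top
    rw [Submodule.mem_orthogonal_singleton_iff_inner_right] at this
    exact inner_self_eq_zero.1 this
  have hsub : ball (0 : E) 1 ⊆ (H ∪ -H) ∪ ((ℝ ∙ u)ᗮ : Set E) := fun x hx => by
    rcases lt_trichotomy ⟪u, x⟫ 0 with h | h | h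
    · refine Or.inl (Or.inr ⟨by simpa using hx, ?_⟩)
      rw [inner_neg_right]
      linarith
    · exact Or.inr ((Submodule.mem_orthogonal_singleton_iff_inner_right).2 h)
    · exact Or.inl (Or.inl ⟨hx, h⟩)
  calc volume (ball (0 : E) 1) ≤ volume (H ∪ -H) + volume ((ℝ ∙ u)ᗮ : Set E) :=
        (measure_mono hsub).trans (measure_union_le _ _)
    _ ≤ volume H + volume (-H) := by rw [hplane, add_zero]; exact measure_union_le _ _
    _ = 2 * volume H := by rw [Measure.measure_neg, two_mul]

theorem exists_lt_volume_capCone {E : Type*} [NormedAddCommGroup E]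
    [InnerProductSpace ℝ E] [FiniteDimensional ℝ E] [MeasurableSpace E] [BorelSpace E]
    {u : E} (hu : u ≠ 0) {a ε : ℝ} (ha : 0 ≤ a) (hε : ε < 1 / 2) :
    ∃ M, ∀ η, M ≤ η →
      ENNReal.ofReal ε * volume (ball (0 : E) 1) < volume (capCone u a η) := by
  set T : ℕ → Set E := fun n => {x | x ∈ ball (0 : E) 1 ∧ 1 / ((n : ℝ) + 1) ≤ ⟪u, x⟫}
  have hmono : Monotone T := fun m n hmn x hx =>
    ⟨hx.1, (one_div_le_one_div_of_le (by positivity) (by gcongr)).trans hx.2⟩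
  have hunion : ⋃ n, T n = {x : E | x ∈ ball (0 : E) 1 ∧ 0 < ⟪u, x⟫} := by
    ext x
    simp only [T, Set.mem_iUnion, Set.mem_ofPred_eq]
    refine ⟨fun ⟨n, h1, h2⟩ => ⟨h1, lt_of_lt_of_le (by positivity) h2⟩, fun ⟨h1, h2⟩ => ?_⟩
    obtain ⟨n, hn⟩ := exists_nat_one_div_lt h2
    exact ⟨n, h1, hn.le⟩
  have hV0 : volume (ball (0 : E) 1) ≠ 0 := (measure_ball_pos _ _ one_pos).ne'
  have hVt : volume (ball (0 : E) 1) ≠ ∞ := measure_ball_lt_top.ne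
  have hlt : ENNReal.ofReal ε * volume (ball (0 : E) 1) < ⨆ n, volume (T n) := by
    rw [← hmono.measure_iUnion, hunion]
    have h2 : ENNReal.ofReal ε < 2⁻¹ := by
      rw [show (2⁻¹ : ℝ≥0∞) = ENNReal.ofReal (1 / 2) by
        rw [one_div, ENNReal.ofReal_inv_of_pos two_pos, ENNReal.ofReal_ofNat]]
      exact (ENNReal.ofReal_lt_ofReal_iff (by norm_num)).2 hε
    refine ((ENNReal.mul_lt_mul_iff_left hV0 hVt).2 h2).trans_le ?_
    rw [mul_comm, ← div_eq_mul_inv]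
    exact ENNReal.div_le_of_le_mul' (volume_ball_le_two_mul_halfBall hu)
  obtain ⟨n, hn⟩ := lt_iSup_iff.1 hlt
  refine ⟨a * (n + 1), fun η hη => hn.trans_le (measure_mono fun x hx => ?_)⟩
  have hpos : 0 < ⟪u, x⟫ := lt_of_lt_of_le (by positivity) hx.2
  refine ⟨hx.1, fun h => by simp [h] at hpos, ?_⟩
  have h1 : 1 ≤ (n + 1) * ⟪u, x⟫ := by
    have := hx.2
    rwa [div_le_iff₀ (by positivity), mul_comm] at this
  calc a * ‖x‖ ≤ a * 1 := by gcongr; exact (mem_ball_zero_iff.1 hx.1).le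
    _ ≤ a * ((n + 1) * ⟪u, x⟫) := by gcongr
    _ = a * (n + 1) * ⟪u, x⟫ := by ring
    _ ≤ η * ⟪u, x⟫ := by gcongr

theorem deltaAdv_affine_le {d : ℕ} {w : EuclideanSpace ℝ (Fin d)} (hw : w ≠ 0) (b : ℝ)
    (x : EuclideanSpace ℝ (Fin d)) :
    deltaAdv (fun y => ⟪w, y⟫ + b) x ≤ |⟪w, x⟫ + b| / ‖w‖ := by
  have hn : 0 < ‖w‖ := norm_pos_iff.2 hw
  refine csInf_le ⟨0, ?_⟩ ⟨-((⟪w, x⟫ + b) / ‖w‖ ^ 2) • w, ?_, ?_⟩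
  · rintro _ ⟨r, rfl, -⟩
    exact norm_nonneg r
  · rw [norm_smul, norm_neg, Real.norm_eq_abs, abs_div, abs_of_pos (pow_pos hn 2)]
    field_simp
  · have : ⟪w, x⟫ + -((⟪w, x⟫ + b) / ‖w‖ ^ 2) * ‖w‖ ^ 2 + b = 0 := by field_simp; ring
    simp only [inner_add_right, inner_smul_right, real_inner_self_eq_norm_sq, this, mul_zero,
      le_refl]

theorem exists_unit_normal_signChange {d : ℕ} {w : EuclideanSpace ℝ (Fin d)} (hw : w ≠ 0) {b : ℝ}
    {x : EuclideanSpace ℝ (Fin d)} (hg : ⟪w, x⟫ + b ≠ 0) :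
    ∃ u : EuclideanSpace ℝ (Fin d), ‖u‖ = 1 ∧
      {n | (⟪w, x⟫ + b) * (⟪w, x + n⟫ + b) ≤ 0} = {n | |⟪w, x⟫ + b| / ‖w‖ ≤ ⟪u, n⟫} := by
  have hn : 0 < ‖w‖ := norm_pos_iff.2 hw
  set g := ⟪w, x⟫ + b with hgdef
  have hg' : 0 < |g| := abs_pos.2 hg
  refine ⟨(-g / (|g| * ‖w‖)) • w, ?_, ?_⟩
  · rw [norm_smul, norm_div, norm_neg, norm_mul, norm_norm, Real.norm_eq_abs, Real.norm_eq_abs,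
      abs_abs]
    field_simp
  · ext n
    simp only [Set.mem_ofPred_eq]
    rw [real_inner_smul_left, div_mul_eq_mul_div, div_le_div_iff₀ hn (by positivity),
      inner_add_right, show |g| * (|g| * ‖w‖) = g ^ 2 * ‖w‖ by rw [← sq_abs]; ring,
      mul_le_mul_iff_left₀ hn, show ⟪w, x⟫ + ⟪w, n⟫ + b = g + ⟪w, n⟫ by rw [hgdef]; ring]
    constructor <;> intro h <;> nlinarith

/-- **Pointwise lower bound (proof of Theorem 2).** For a linear classifier
`f(x) = wᵀx + b` with `w ≠ 0` and `ε ∈ (0, 1/12)`,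
`Δ_unif,ε(x;f) ≥ C₁(ε) √d · Δ_adv(x;f)` with `C₁(ε) = (2 ln(2/ε))^{-1/2}`. -/
theorem linear_deltaUnif_ge_pointwise {d : ℕ} (hd : 0 < d)
    (w : EuclideanSpace ℝ (Fin d)) (hw : w ≠ 0) (b : ℝ)
    (x : EuclideanSpace ℝ (Fin d)) (ε : ℝ) (hε0 : 0 < ε) (hε : ε < 1 / 12) :
    deltaUnif (fun y => ⟪w, y⟫ + b) ε x ≥
      (2 * Real.log (2 / ε)) ^ (-(1 / 2) : ℝ) * Real.sqrt d *
        deltaAdv (fun y => ⟪w, y⟫ + b) x := by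
  have hlog : 0 < Real.log (2 / ε) := Real.log_pos (by rw [lt_div_iff₀ hε0]; linarith)
  have hd' : (0 : ℝ) < d := by exact_mod_cast hd
  set L := 2 * Real.log (2 / ε) with hL
  have hLpos : 0 < L := by positivity
  set C := L ^ (-(1 / 2) : ℝ) * √d with hC
  have hCpos : 0 < C := by positivity
  have hC2 : C ^ 2 = d / L := by
    rw [hC, mul_pow, Real.sq_sqrt hd'.le, ← Real.rpow_mul_natCast hLpos.le,
      show (-(1 / 2) : ℝ) * (2 : ℕ) = -1 by norm_num, Real.rpow_neg_one]
    ring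
  refine ge_iff_le.2 ((mul_le_mul_of_nonneg_left (deltaAdv_affine_le hw b x) hCpos.le).trans ?_)
  by_cases hg : ⟪w, x⟫ + b = 0
  · rw [hg, abs_zero, zero_div, mul_zero]
    exact Real.sSup_nonneg fun η hη => hη.1
  obtain ⟨u, hu, hset⟩ := exists_unit_normal_signChange hw hg
  have hu0 : u ≠ 0 := norm_pos_iff.1 (by rw [hu]; exact one_pos)
  set a := |⟪w, x⟫ + b| / ‖w‖
  have ha : 0 < a := div_pos (abs_pos.2 hg) (norm_pos_iff.2 hw)
  have hV0 : volume (ball (0 : EuclideanSpace ℝ (Fin d)) 1) ≠ 0 :=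
    (measure_ball_pos _ _ one_pos).ne'
  have hVt : volume (ball (0 : EuclideanSpace ℝ (Fin d)) 1) ≠ ∞ := measure_ball_lt_top.ne
  have hiff : ∀ η, unifSphere d η {n | a ≤ ⟪u, n⟫} ≤ ENNReal.ofReal ε ↔
      volume (capCone u a η) ≤
        ENNReal.ofReal ε * volume (ball (0 : EuclideanSpace ℝ (Fin d)) 1) := fun η => by
    rw [unifSphere_halfSpace hd, mul_comm, ← div_eq_mul_inv,
      ENNReal.div_le_iff hV0 hVt]
  simp only [deltaUnif, hset, hiff]
  refine le_csSup ?_ ⟨by positivity, ?_⟩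
  · obtain ⟨M, hM⟩ := exists_lt_volume_capCone hu0 ha.le (show ε < 1 / 2 by linarith)
    refine ⟨M, fun η hη => ?_⟩
    by_contra! h
    exact (hM η h.le).not_ge hη.2
  · refine (volume_capCone_le hu ha.le (by positivity)).trans ?_
    gcongr
    have h1 : (a / (C * a)) ^ 2 = L / d := by
      rw [div_mul_cancel_right₀ ha.ne', inv_pow, hC2, inv_div]
    rw [h1, show -(d * (L / d)) / 2 = -Real.log (2 / ε) by rw [hL]; field_simp, Real.exp_neg,
      Real.exp_log (by positivity), inv_div]
    linarith
end

section
/- Let f_quad : ℝ⁴ → ℝ be defined by f_quad(x) = x₁x₂ + x₃x₄ − x₁x₃ − x₂x₄, let a ∈ ℝ, and let x = (1+a, 1+a, a, a). Then inf{‖r‖₂ : r ∈ ℝ⁴, f_quad(x + r) ≤ 0} = 1/√2, and the infimum is attained at r = (0, −1/2, 1/2, 0). -/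
/-- The quadratic classifier `f_quad(x) = x₁x₂ + x₃x₄ − x₁x₃ − x₂x₄` on `ℝ⁴`. -/
def fQuad (x : EuclideanSpace ℝ (Fin 4)) : ℝ :=
  x 0 * x 1 + x 2 * x 3 - x 0 * x 2 - x 1 * x 3

theorem fQuad_eq_mul (x : EuclideanSpace ℝ (Fin 4)) :
    fQuad x = (x 0 - x 3) * (x 1 - x 2) := by
  unfold fQuad
  ring

/-- A vector two of whose coordinates differ by at least `1` has norm at least `1/√2`. -/
theorem one_div_sqrt_two_le_norm {ι : Type*} [Fintype ι] [DecidableEq ι]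
    {r : EuclideanSpace ℝ ι} {i j : ι} (hij : i ≠ j) (h : 1 ≤ r j - r i) :
    1 / Real.sqrt 2 ≤ ‖r‖ := by
  have hsum : r i ^ 2 + r j ^ 2 ≤ ‖r‖ ^ 2 := by
    rw [EuclideanSpace.real_norm_sq_eq, ← Finset.sum_pair (f := fun k => r k ^ 2) hij]
    exact Finset.sum_le_sum_of_subset_of_nonneg (Finset.subset_univ _)
      fun k _ _ => sq_nonneg (r k)
  refine abs_le_of_sq_le_sq' ?_ (norm_nonneg r) |>.2
  rw [div_pow, Real.sq_sqrt zero_le_two]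
  nlinarith [sq_nonneg (r i + r j)]

/-- **Adversarial robustness of `f_quad` on the running example.**
For `x = (1+a, 1+a, a, a)`, the minimal norm of a perturbation `r` with
`f_quad(x + r) ≤ 0` equals `1/√2`, attained at `r = (0, −1/2, 1/2, 0)`. -/
theorem fQuad_adv_perturbation (a : ℝ)
    (x r : EuclideanSpace ℝ (Fin 4))
    (hx : x = (WithLp.equiv 2 (Fin 4 → ℝ)).symm ![1 + a, 1 + a, a, a])
    (hr : r = (WithLp.equiv 2 (Fin 4 → ℝ)).symm ![0, -(1 / 2), 1 / 2, 0]) :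
    sInf {t : ℝ | ∃ r' : EuclideanSpace ℝ (Fin 4), ‖r'‖ = t ∧ fQuad (x + r') ≤ 0} =
      1 / Real.sqrt 2 ∧
    ‖r‖ = 1 / Real.sqrt 2 ∧ fQuad (x + r) ≤ 0 := by
  have hfx (r' : EuclideanSpace ℝ (Fin 4)) :
      fQuad (x + r') = (1 + (r' 0 - r' 3)) * (1 + (r' 1 - r' 2)) := by
    rw [fQuad_eq_mul]
    simp [hx]
    ring
  have hnorm : ‖r‖ = 1 / Real.sqrt 2 := by
    rw [EuclideanSpace.norm_eq, one_div, ← Real.sqrt_inv]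
    congr 1
    simp [hr, Fin.sum_univ_four]
    norm_num
  have hle : fQuad (x + r) ≤ 0 := by
    rw [hfx]
    simp [hr]
    norm_num
  refine ⟨IsLeast.csInf_eq ⟨⟨r, hnorm, hle⟩, ?_⟩, hnorm, hle⟩
  rintro t ⟨r', rfl, hr'⟩
  rw [hfx] at hr'
  rcases mul_nonpos_iff.mp hr' with ⟨-, h⟩ | ⟨h, -⟩
  · exact one_div_sqrt_two_le_norm (i := 1) (j := 2) (by decide) (by linarith)
  · exact one_div_sqrt_two_le_norm (i := 0) (j := 3) (by decide) (by linarith)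
end
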